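/- Suppose Assumptions 1, 2, 3, and 4 hold. If the quantization density ρ ∈ (0,1) and the threshold parameter σ ∈ (0, σ₀] satisfy Γ L_op(1−ρ)/(1+ρ) < σ < 2cρ/(αL_cl(1+ρ)) =: σ₁, then for every initial state x₀ ∈ B_cl(R/L_cl) and every τ_max > 0, the closed-loop system with the logarithmic-quantization self-triggering mechanism satisfies: (i) t_{k+1} − t_k ≥ min{τ_max, τ_min, τ̃_min} > 0 for all k ∈ ℤ_{≥0}; (ii) there exists a unique solution x of the closed-loop system on [0,∞); (iii) this solution satisfies ‖x(t)‖_cl ≤ e^{−γt}‖x₀‖_cl for all t ≥ 0, where γ := −(1/τ_max)·log(e^{−cτ_max}(1 − σ/σ₁) + σ/σ₁) > 0. -/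

import Mathlib

set_option autoImplicit false

open Filter Set MeasureTheory Real
open scoped Topology ENNReal

noncomputable section

/-- `N` is a norm on `ℝ^n`. -/
structure IsVecNorm {n : ℕ} (N : (Fin n → ℝ) → ℝ) : Prop where
  eq_zero : ∀ x, N x = 0 ↔ x = 0
  smul_eq : ∀ (a : ℝ) (x : Fin n → ℝ), N (a • x) = |a| * N x
  add_le : ∀ x y : Fin n → ℝ, N (x + y) ≤ N x + N y

/-- The matrix norm induced by the vector norm `N`. -/
def matNorm {n : ℕ} (N : (Fin n → ℝ) → ℝ) (A : Matrix (Fin n) (Fin n) ℝ) : ℝ :=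
  sSup {c : ℝ | ∃ x : Fin n → ℝ, N x = 1 ∧ c = N (A.mulVec x)}

/-- The logarithmic norm `μ_N(A) = lim_{ε→0⁺} (‖I+εA‖_N − 1)/ε`. -/
def logNorm {n : ℕ} (N : (Fin n → ℝ) → ℝ) (A : Matrix (Fin n) (Fin n) ℝ) : ℝ :=
  limUnder (𝓝[>] (0 : ℝ)) (fun ε : ℝ => (matNorm N (1 + ε • A) - 1) / ε)

/-- The Jacobian matrix of `F` at `x`. -/
def jacobian {n : ℕ} (F : (Fin n → ℝ) → (Fin n → ℝ)) (x : Fin n → ℝ) :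
    Matrix (Fin n) (Fin n) ℝ :=
  Matrix.of fun i j => fderiv ℝ F x (Pi.single j 1) i

/-- Open ball of radius `r` centered at `0` w.r.t. the norm `N`. -/
def nball {n : ℕ} (N : (Fin n → ℝ) → ℝ) (r : ℝ) : Set (Fin n → ℝ) := {x | N x < r}

/-- `ν(t) = d₂ ∫₀ᵗ e^{d₁ s} ds`. -/
def nu (d₁ d₂ t : ℝ) : ℝ := d₂ * ∫ s in (0:ℝ)..t, Real.exp (d₁ * s)

/-- Diagonally-weighted r-norm `‖x‖_{r,[θ]} = ‖[θ]x‖_r`. -/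
def wnorm {n : ℕ} (r : ℝ≥0∞) (θ x : Fin n → ℝ) : ℝ :=
  ‖(WithLp.equiv r (∀ _ : Fin n, ℝ)).symm (fun i => θ i * x i)‖

/-- The function `ψ_log`. -/
def psiLog {n : ℕ} (Nop : (Fin n → ℝ) → ℝ) (d₁ Lop ρ : ℝ)
    (X : (Fin n → ℝ) → ℝ → (Fin n → ℝ)) (s : ℝ) (q : Fin n → ℝ) : ℝ :=
  Lop * (1 - ρ) / (1 + ρ) * Real.exp (d₁ * s) * Nop q + Nop (X q s - q)

open Classical in
/-- The time `τ̃_k` of the self-triggering mechanism. -/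
def tauTilde {n : ℕ} (Nop : (Fin n → ℝ) → ℝ) (R₂ τmax : ℝ)
    (X : (Fin n → ℝ) → ℝ → (Fin n → ℝ)) (q : Fin n → ℝ) : ℝ :=
  if ∀ s ∈ Set.Ioo (0:ℝ) τmax, Nop (X q s) < R₂ then τmax
  else sInf {s : ℝ | 0 < s ∧ R₂ ≤ Nop (X q s)}

open Classical in
/-- The inter-sampling time `τ_k` of the self-triggering mechanism. -/
def tauSamp {n : ℕ} (Ncl Nop : (Fin n → ℝ) → ℝ) (R₂ τmax σ d₁ Lop ρ : ℝ)
    (X : (Fin n → ℝ) → ℝ → (Fin n → ℝ)) (q : Fin n → ℝ) : ℝ :=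
  if ∀ s ∈ Set.Ioo (0:ℝ) (tauTilde Nop R₂ τmax X q), psiLog Nop d₁ Lop ρ X s q ≤ σ * Ncl q
  then tauTilde Nop R₂ τmax X q
  else sInf {s : ℝ | 0 < s ∧ σ * Ncl q < psiLog Nop d₁ Lop ρ X s q}

/-- The closed-loop system (16) together with the STM (17). -/
def ClosedLoopLog {n m : ℕ}
    (f : (Fin n → ℝ) → (Fin m → ℝ) → (Fin n → ℝ)) (g : (Fin n → ℝ) → (Fin m → ℝ))
    (Ncl Nop : (Fin n → ℝ) → ℝ) (R₂ τmax σ d₁ Lop ρ : ℝ)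
    (X : (Fin n → ℝ) → ℝ → (Fin n → ℝ)) (Qlog : (Fin n → ℝ) → (Fin n → ℝ))
    (x₀ : Fin n → ℝ) (x : ℝ → (Fin n → ℝ)) (t : ℕ → ℝ) (q : ℕ → (Fin n → ℝ)) : Prop :=
  t 0 = 0 ∧ x 0 = x₀ ∧ Continuous x ∧
  (∀ k : ℕ, q k = Qlog (x (t k))) ∧
  (∀ k : ℕ, t (k + 1) = t k + tauSamp Ncl Nop R₂ τmax σ d₁ Lop ρ X (q k)) ∧
  (∀ k : ℕ, ∀ s ∈ Set.Ico (t k) (t (k + 1)),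
    HasDerivWithinAt x (f (x s) (g (q k))) (Set.Ici s) s)


namespace IsVecNorm
variable {n : ℕ} {N : (Fin n → ℝ) → ℝ}

lemma map_zero (h : IsVecNorm N) : N 0 = 0 := (h.eq_zero 0).2 rfl

lemma map_neg (h : IsVecNorm N) (x : Fin n → ℝ) : N (-x) = N x := by
  have := h.smul_eq (-1) x
  simpa using this

lemma nonneg (h : IsVecNorm N) (x : Fin n → ℝ) : 0 ≤ N x := by
  have h1 := h.add_le x (-x)
  rw [h.map_neg, add_neg_cancel, h.map_zero] at h1
  linarith

lemma sub_le (h : IsVecNorm N) (x y : Fin n → ℝ) : N (x - y) ≤ N x + N y := by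
  have := h.add_le x (-y)
  rwa [h.map_neg, ← sub_eq_add_neg] at this

lemma sub_rev (h : IsVecNorm N) (x y : Fin n → ℝ) : N (x - y) = N (y - x) := by
  rw [← h.map_neg, neg_sub]

lemma le_add_sub (h : IsVecNorm N) (x y : Fin n → ℝ) : N x ≤ N y + N (x - y) := by
  have := h.add_le y (x - y)
  simpa using this

lemma pos (h : IsVecNorm N) {x : Fin n → ℝ} (hx : x ≠ 0) : 0 < N x :=
  lt_of_le_of_ne (h.nonneg x) (fun h0 => hx ((h.eq_zero x).1 h0.symm))

lemma sum_le (h : IsVecNorm N) {ι : Type*} (s : Finset ι) (v : ι → Fin n → ℝ) :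
    N (∑ i ∈ s, v i) ≤ ∑ i ∈ s, N (v i) := by
  classical
  induction s using Finset.induction_on with
  | empty => simp [h.map_zero]
  | insert a s ha ih =>
    rw [Finset.sum_insert ha, Finset.sum_insert ha]
    exact (h.add_le _ _).trans (by linarith)

lemma exists_upper (h : IsVecNorm N) : ∃ C : ℝ, 0 < C ∧ ∀ x, N x ≤ C * ‖x‖ := by
  refine ⟨∑ i : Fin n, N (Pi.single i 1) + 1, ?_, ?_⟩
  · have : 0 ≤ ∑ i : Fin n, N (Pi.single i 1) := Finset.sum_nonneg (fun i _ => h.nonneg _)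
    linarith
  · intro x
    have hx : x = ∑ i : Fin n, x i • (Pi.single i (1:ℝ) : Fin n → ℝ) := by
      ext j
      simp [Finset.sum_apply, Pi.single_apply]
    calc N x = N (∑ i : Fin n, x i • (Pi.single i (1:ℝ) : Fin n → ℝ)) := by rw [← hx]
      _ ≤ ∑ i : Fin n, N (x i • (Pi.single i (1:ℝ) : Fin n → ℝ)) := h.sum_le _ _
      _ ≤ ∑ i : Fin n, ‖x‖ * N (Pi.single i (1:ℝ)) := by
          apply Finset.sum_le_sum
          intro i _
          rw [h.smul_eq]
          exact mul_le_mul_of_nonneg_right (norm_le_pi_norm x i) (h.nonneg _)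
      _ = (∑ i : Fin n, N (Pi.single i 1)) * ‖x‖ := by rw [← Finset.mul_sum, mul_comm]
      _ ≤ _ := by
          have := norm_nonneg x
          nlinarith

lemma continuous (h : IsVecNorm N) : Continuous N := by
  obtain ⟨C, hC, hb⟩ := h.exists_upper
  have : LipschitzWith (Real.toNNReal C) N := by
    apply LipschitzWith.of_le_add_mul
    intro x y
    rw [Real.coe_toNNReal C hC.le, dist_eq_norm]
    have := h.le_add_sub x y
    have := hb (x - y)
    linarith
  exact this.continuous

lemma exists_lower (h : IsVecNorm N) : ∃ C : ℝ, 0 < C ∧ ∀ x, ‖x‖ ≤ C * N x := by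
  by_cases hne : (Metric.sphere (0 : Fin n → ℝ) 1).Nonempty
  · obtain ⟨z, hz, hmin⟩ := (isCompact_sphere (0 : Fin n → ℝ) 1).exists_isMinOn hne
      h.continuous.continuousOn
    have hz1 : ‖z‖ = 1 := by simpa using hz
    have hzpos : 0 < N z := h.pos (by rintro rfl; simp at hz1)
    refine ⟨(N z)⁻¹, inv_pos.2 hzpos, ?_⟩
    intro x
    by_cases hx : x = 0
    · subst hx; simp [h.map_zero]
    · have hxn : 0 < ‖x‖ := norm_pos_iff.2 hx
      have h1 : N z ≤ N (‖x‖⁻¹ • x) := by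
        apply hmin
        simp [norm_smul, hxn.ne']
      rw [h.smul_eq, abs_of_pos (inv_pos.2 hxn)] at h1
      rw [inv_mul_eq_div, le_div_iff₀ hzpos]
      rw [inv_mul_eq_div, le_div_iff₀ hxn] at h1
      linarith
  · refine ⟨1, one_pos, ?_⟩
    intro x
    by_cases hx : x = 0
    · subst hx; simp [h.map_zero]
    · exfalso
      apply hne
      refine ⟨‖x‖⁻¹ • x, ?_⟩
      have hxn : 0 < ‖x‖ := norm_pos_iff.2 hx
      simp [norm_smul, hxn.ne']

lemma isOpen_nball (h : IsVecNorm N) (r : ℝ) : IsOpen (nball N r) :=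
  isOpen_lt h.continuous continuous_const

lemma convex_lt (h : IsVecNorm N) (r : ℝ) : Convex ℝ (nball N r) := by
  intro x hx y hy a b ha hb hab
  simp only [nball, mem_ofPred_eq] at *
  have h1 := h.add_le (a • x) (b • y)
  rw [h.smul_eq, h.smul_eq, abs_of_nonneg ha, abs_of_nonneg hb] at h1
  rcases ha.eq_or_lt with h0 | h0
  · have : b = 1 := by linarith
    subst this; subst h0; simpa using hy
  · have e1 : a * N x < a * r := mul_lt_mul_of_pos_left hx h0
    have e2 : b * N y ≤ b * r := mul_le_mul_of_nonneg_left hy.le hb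
    have e3 : a * r + b * r = r := by rw [← add_mul, hab, one_mul]
    linarith

lemma convex_le (h : IsVecNorm N) (r : ℝ) : Convex ℝ {x | N x ≤ r} := by
  intro x hx y hy a b ha hb hab
  simp only [mem_ofPred_eq] at *
  have h1 := h.add_le (a • x) (b • y)
  rw [h.smul_eq, h.smul_eq, abs_of_nonneg ha, abs_of_nonneg hb] at h1
  have e1 : a * N x ≤ a * r := mul_le_mul_of_nonneg_left hx ha
  have e2 : b * N y ≤ b * r := mul_le_mul_of_nonneg_left hy hb
  have e3 : a * r + b * r = r := by rw [← add_mul, hab, one_mul]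
  linarith

lemma isCompact_le (h : IsVecNorm N) (r : ℝ) : IsCompact {x | N x ≤ r} := by
  obtain ⟨C, hC, hb⟩ := h.exists_lower
  apply Metric.isCompact_of_isClosed_isBounded (isClosed_le h.continuous continuous_const)
  apply (Metric.isBounded_closedBall (x := (0 : Fin n → ℝ)) (r := C * r)).subset
  intro x hx
  simp only [mem_ofPred_eq] at hx
  simp only [Metric.mem_closedBall, dist_zero_right]
  exact (hb x).trans (mul_le_mul_of_nonneg_left hx hC.le)

lemma matNorm_bdd (h : IsVecNorm N) (A : Matrix (Fin n) (Fin n) ℝ) :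
    BddAbove {c : ℝ | ∃ x : Fin n → ℝ, N x = 1 ∧ c = N (A.mulVec x)} := by
  have hcont : Continuous (fun x : Fin n → ℝ => N (A.mulVec x)) :=
    h.continuous.comp (Continuous.matrix_mulVec continuous_const continuous_id)
  have := (h.isCompact_le 1).bddAbove_image hcont.continuousOn
  refine this.mono ?_
  rintro c ⟨x, hx, rfl⟩
  exact ⟨x, hx.le, rfl⟩

lemma mulVec_le (h : IsVecNorm N) (A : Matrix (Fin n) (Fin n) ℝ) (x : Fin n → ℝ) :
    N (A.mulVec x) ≤ matNorm N A * N x := by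
  by_cases hx : x = 0
  · subst hx; simp [h.map_zero]
  · have hxn := h.pos hx
    have : N (A.mulVec ((N x)⁻¹ • x)) ≤ matNorm N A := by
      apply le_csSup (h.matNorm_bdd A)
      refine ⟨_, ?_, rfl⟩
      rw [h.smul_eq, abs_of_pos (inv_pos.2 hxn), inv_mul_cancel₀ hxn.ne']
    rw [Matrix.mulVec_smul, h.smul_eq, abs_of_pos (inv_pos.2 hxn), inv_mul_eq_div,
      div_le_iff₀ hxn] at this
    exact this

lemma exists_unit (h : IsVecNorm N) (hn : 0 < n) : ∃ x, N x = 1 := by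
  let e : Fin n → ℝ := Pi.single ⟨0, hn⟩ 1
  have he : e ≠ 0 := by
    intro h0
    have := congrFun h0 ⟨0, hn⟩
    simp [e] at this
  have hp := h.pos he
  exact ⟨(N e)⁻¹ • e, by rw [h.smul_eq, abs_of_pos (inv_pos.2 hp), inv_mul_cancel₀ hp.ne']⟩

lemma matNorm_le (h : IsVecNorm N) (hn : 0 < n) (A : Matrix (Fin n) (Fin n) ℝ) (C : ℝ)
    (hC : ∀ x, N x = 1 → N (A.mulVec x) ≤ C) : matNorm N A ≤ C := by
  apply csSup_le
  · obtain ⟨x, hx⟩ := h.exists_unit hn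
    exact ⟨_, x, hx, rfl⟩
  · rintro c ⟨x, hx, rfl⟩
    exact hC x hx

lemma slope_mono (h : IsVecNorm N) (hn : 0 < n) (A : Matrix (Fin n) (Fin n) ℝ) :
    MonotoneOn (fun ε : ℝ => (matNorm N (1 + ε • A) - 1) / ε) (Ioi 0) := by
  intro a ha b hb hab
  simp only [mem_Ioi] at ha hb
  simp only
  rw [div_le_div_iff₀ ha hb]
  have : matNorm N (1 + a • A) ≤ (1 - a / b) + a / b * matNorm N (1 + b • A) := by
    apply h.matNorm_le hn
    intro x hx
    have e : (1 + a • A).mulVec x = (1 - a / b) • x + (a / b) • (1 + b • A).mulVec x := by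
      simp only [Matrix.add_mulVec, Matrix.one_mulVec, Matrix.smul_mulVec]
      ext i
      simp only [Pi.add_apply, Pi.smul_apply, smul_eq_mul]
      field_simp
      ring
    rw [e]
    refine (h.add_le _ _).trans ?_
    rw [h.smul_eq, h.smul_eq, abs_of_nonneg (by positivity : 0 ≤ a / b),
      abs_of_nonneg (by rw [sub_nonneg, div_le_one hb]; exact hab), hx]
    have := h.mulVec_le (1 + b • A) x
    rw [hx, mul_one] at this
    have := mul_le_mul_of_nonneg_left this (by positivity : 0 ≤ a / b)
    linarith
  have h2 := mul_le_mul_of_nonneg_right this hb.le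
  have e2 : (1 - a / b + a / b * matNorm N (1 + b • A)) * b = b - a + a * matNorm N (1 + b • A) := by
    field_simp
  rw [e2] at h2
  linarith

lemma slope_bdd (h : IsVecNorm N) (hn : 0 < n) (A : Matrix (Fin n) (Fin n) ℝ) (ε : ℝ) (hε : 0 < ε) :
    - matNorm N A ≤ (matNorm N (1 + ε • A) - 1) / ε := by
  rw [le_div_iff₀ hε]
  obtain ⟨x, hx⟩ := h.exists_unit hn
  have h1 := h.mulVec_le (1 + ε • A) x
  have h2 := h.mulVec_le A x
  rw [hx, mul_one] at h1 h2
  have h3 := h.sub_le ((1 + ε • A).mulVec x) (ε • A.mulVec x)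
  rw [h.smul_eq, abs_of_pos hε] at h3
  simp only [Matrix.add_mulVec, Matrix.one_mulVec, Matrix.smul_mulVec, add_sub_cancel_right] at h3 h1
  rw [hx] at h3
  nlinarith

lemma tendsto_logNorm (h : IsVecNorm N) (hn : 0 < n) (A : Matrix (Fin n) (Fin n) ℝ) :
    Tendsto (fun ε : ℝ => (matNorm N (1 + ε • A) - 1) / ε) (𝓝[>] 0) (𝓝 (logNorm N A)) := by
  have := (h.slope_mono hn A).tendsto_nhdsGT (x := 0) ⟨- matNorm N A, by
    rintro _ ⟨ε, hε, rfl⟩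
    exact h.slope_bdd hn A ε hε⟩
  exact tendsto_nhds_limUnder ⟨_, this⟩

/-- norming functional -/
lemma exists_functional (h : IsVecNorm N) (v : Fin n → ℝ) :
    ∃ φ : (Fin n → ℝ) →ₗ[ℝ] ℝ, φ v = N v ∧ ∀ x, φ x ≤ N x := by
  by_cases hv : v = 0
  · refine ⟨0, ?_, fun x => ?_⟩
    · simp [hv, h.map_zero]
    · simpa using h.nonneg x
  · obtain ⟨φ, h1, h2⟩ := exists_extension_of_le_sublinear
      (LinearPMap.mkSpanSingleton v (N v) hv) N
      (fun c hc x => by rw [h.smul_eq, abs_of_pos hc]) h.add_le (by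
        rintro ⟨x, hx⟩
        obtain ⟨a, rfl⟩ := Submodule.mem_span_singleton.1 hx
        rw [LinearPMap.mkSpanSingleton'_apply, h.smul_eq, smul_eq_mul]
        exact mul_le_mul_of_nonneg_right (le_abs_self a) (h.nonneg v))
    refine ⟨φ, ?_, h2⟩
    have := h1 ⟨v, Submodule.mem_span_singleton_self v⟩
    simp only at this
    rw [this]
    exact LinearPMap.mkSpanSingleton_apply ℝ ℝ hv (N v)

lemma functional_le (h : IsVecNorm N) (hn : 0 < n) (A : Matrix (Fin n) (Fin n) ℝ) (v : Fin n → ℝ)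
    (φ : (Fin n → ℝ) →ₗ[ℝ] ℝ) (h1 : φ v = N v) (h2 : ∀ x, φ x ≤ N x) :
    φ (A.mulVec v) ≤ logNorm N A * N v := by
  have ht := (h.tendsto_logNorm hn A).mul_const (N v)
  refine ge_of_tendsto ht ?_
  filter_upwards [self_mem_nhdsWithin] with ε hε
  simp only [mem_Ioi] at hε
  have h3 := (h2 ((1 + ε • A).mulVec v)).trans (h.mulVec_le _ _)
  simp only [Matrix.add_mulVec, Matrix.one_mulVec, Matrix.smul_mulVec, _root_.map_add, _root_.map_smul,
    smul_eq_mul, h1] at h3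
  rw [div_mul_eq_mul_div, le_div_iff₀ hε]
  linarith

end IsVecNorm

lemma jacobian_mulVec {n : ℕ} (F : (Fin n → ℝ) → (Fin n → ℝ)) (x v : Fin n → ℝ) :
    (jacobian F x).mulVec v = fderiv ℝ F x v := by
  have hv : v = ∑ i : Fin n, v i • (Pi.single i (1:ℝ) : Fin n → ℝ) := by
    ext j
    simp [Finset.sum_apply, Pi.single_apply]
  conv_rhs => rw [hv]
  ext i
  simp [Matrix.mulVec, dotProduct, jacobian, map_sum, Finset.sum_apply, mul_comm]

lemma seg_bound {n : ℕ} {N : (Fin n → ℝ) → ℝ} (h : IsVecNorm N) (hn : 0 < n)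
    {D : Set (Fin n → ℝ)} (hDc : Convex ℝ D)
    {G : (Fin n → ℝ) → (Fin n → ℝ)} (hG : LocallyLipschitzOn D G) {L : ℝ}
    {z v : Fin n → ℝ} (hz : z ∈ D) (hzv : z + v ∈ D)
    (hae : ∀ᵐ s : ℝ, z + s • v ∈ D →
      DifferentiableAt ℝ G (z + s • v) ∧ logNorm N (jacobian G (z + s • v)) ≤ L)
    (φ : (Fin n → ℝ) →ₗ[ℝ] ℝ) (h1 : φ v = N v) (h2 : ∀ w, φ w ≤ N w) :
    φ (G (z + v) - G z) ≤ L * N v := by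
  let φc : (Fin n → ℝ) →L[ℝ] ℝ := LinearMap.toContinuousLinearMap φ
  have hφc : ∀ w, φc w = φ w := fun w => rfl
  let γ : ℝ → (Fin n → ℝ) := fun s => z + s • v
  have hγD : ∀ s ∈ Icc (0:ℝ) 1, γ s ∈ D := by
    intro s hs
    have := hDc.add_smul_sub_mem hz hzv hs
    simpa [γ] using this
  have hγL : LipschitzWith ‖v‖₊ γ := by
    apply LipschitzWith.of_dist_le_mul
    intro a b
    simp only [γ, dist_add_left]
    rw [dist_eq_norm, ← sub_smul, norm_smul, coe_nnnorm, mul_comm, dist_eq_norm]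
  obtain ⟨K, hK⟩ := LocallyLipschitzOn.exists_lipschitzOnWith_of_compact
    (isCompact_Icc.image hγL.continuous) (hG.mono (s := γ '' Icc 0 1) (by
      rintro _ ⟨s, hs, rfl⟩; exact hγD s hs))
  have hu : LipschitzOnWith (‖φc‖₊ * (K * ‖v‖₊)) (fun s => φc (G (γ s))) (uIcc (0:ℝ) 1) := by
    rw [uIcc_of_le zero_le_one]
    exact φc.lipschitz.comp_lipschitzOnWith
      (hK.comp (hγL.lipschitzOnWith) (mapsTo_image _ _))
  have hac := hu.absolutelyContinuousOnInterval
  have hint := hac.integral_deriv_eq_sub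
  have hle : (∫ s in (0:ℝ)..1, deriv (fun s => φc (G (γ s))) s) ≤ ∫ s in (0:ℝ)..1, L * N v := by
    rw [intervalIntegral.integral_of_le zero_le_one, intervalIntegral.integral_of_le zero_le_one]
    apply setIntegral_mono_on_ae
    · exact hac.intervalIntegrable_deriv.1
    · exact (intervalIntegrable_const (μ := volume) (a := (0:ℝ)) (b := 1)).1
    · exact measurableSet_Ioc
    · filter_upwards [hae] with s hs hs01
      obtain ⟨hd, hl⟩ := hs (hγD s ⟨hs01.1.le, hs01.2⟩)
      have hγd : HasDerivAt γ v s := by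
        have := ((hasDerivAt_id s).smul_const v).const_add z
        simpa [γ] using this
      have hder : HasDerivAt (fun s => φc (G (γ s))) (φc (fderiv ℝ G (γ s) v)) s :=
        φc.hasFDerivAt.comp_hasDerivAt s (hd.hasFDerivAt.comp_hasDerivAt s hγd)
      rw [hder.deriv, hφc, ← jacobian_mulVec]
      exact (h.functional_le hn _ v φ h1 h2).trans (mul_le_mul_of_nonneg_right hl (h.nonneg v))
  rw [hint] at hle
  simp only [intervalIntegral.integral_const, sub_zero, one_smul, hφc, γ, zero_smul, add_zero] at hle
  rw [map_sub]
  exact hle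

lemma onesided {n : ℕ} {N : (Fin n → ℝ) → ℝ} (h : IsVecNorm N) (hn : 0 < n)
    {D : Set (Fin n → ℝ)} (hDo : IsOpen D) (hDc : Convex ℝ D)
    {G : (Fin n → ℝ) → (Fin n → ℝ)} (hG : LocallyLipschitzOn D G) {L : ℝ}
    (hae : ∀ᵐ x ∂(volume : Measure (Fin n → ℝ)), x ∈ D →
      DifferentiableAt ℝ G x ∧ logNorm N (jacobian G x) ≤ L)
    {x y : Fin n → ℝ} (hx : x ∈ D) (hy : y ∈ D)
    (φ : (Fin n → ℝ) →ₗ[ℝ] ℝ) (h1 : φ (x - y) = N (x - y)) (h2 : ∀ w, φ w ≤ N w) :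
    φ (G x - G y) ≤ L * N (x - y) := by
  set v := x - y with hv
  have hxv : x = y + v := by simp [hv]
  rw [hxv] at hx ⊢
  obtain ⟨S, hS, hSm, hSP⟩ := hae.exists_measurable_mem
  have hS' : ∀ᵐ z ∂(volume : Measure (Fin n → ℝ)), z ∈ S := hS
  have hgood := (ae_ae_add_linearMap_mem_iff (LinearMap.toSpanSingleton ℝ (Fin n → ℝ) v)
    (volume : Measure ℝ) (volume : Measure (Fin n → ℝ)) hSm).2 hS'
  have hdense := Measure.dense_of_ae hgood
  have hfreq := mem_closure_iff_frequently.1 (hdense y)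
  by_contra hcon
  push Not at hcon
  have hφ : Continuous φ := φ.continuous_of_finiteDimensional
  have hGc := hG.continuousOn
  have e1 : ∀ᶠ z in 𝓝 y, z ∈ D := hDo.mem_nhds hy
  have hadd : Tendsto (fun z => z + v) (𝓝 y) (𝓝 (y + v)) :=
    (continuous_id.add continuous_const).tendsto y
  have e2 : ∀ᶠ z in 𝓝 y, z + v ∈ D := hadd (hDo.mem_nhds hx)
  have ht : Tendsto (fun z => φ (G (z + v) - G z)) (𝓝 y) (𝓝 (φ (G (y + v) - G y))) := by
    apply (hφ.tendsto _).comp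
    apply Tendsto.sub
    · exact ((hGc.continuousAt (hDo.mem_nhds hx)).tendsto).comp hadd
    · exact hGc.continuousAt (hDo.mem_nhds hy)
  have e3 := ht.eventually_const_lt hcon
  obtain ⟨z, hz, hz1, hz2, hz3⟩ := (hfreq.and_eventually (e1.and (e2.and e3))).exists
  have := seg_bound h hn hDc hG hz1 hz2 (v := v) (L := L) (by
    have hz' : ∀ᵐ s : ℝ, z + (LinearMap.toSpanSingleton ℝ (Fin n → ℝ) v) s ∈ S := hz
    filter_upwards [hz'] with s hs
    exact hSP _ hs) φ h1 h2
  linarith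

/-- implicit Euler form of the one-sided estimate -/
lemma accretive {n : ℕ} {N : (Fin n → ℝ) → ℝ} (h : IsVecNorm N) (hn : 0 < n)
    {D : Set (Fin n → ℝ)} (hDo : IsOpen D) (hDc : Convex ℝ D)
    {G : (Fin n → ℝ) → (Fin n → ℝ)} (hG : LocallyLipschitzOn D G) {L : ℝ}
    (hae : ∀ᵐ x ∂(volume : Measure (Fin n → ℝ)), x ∈ D →
      DifferentiableAt ℝ G x ∧ logNorm N (jacobian G x) ≤ L)
    (x y : Fin n → ℝ) (hx : x ∈ D) (hy : y ∈ D) (ε : ℝ) (hε : 0 ≤ ε) :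
    (1 - L * ε) * N (x - y) ≤ N ((x - y) - ε • (G x - G y)) := by
  obtain ⟨φ, h1, h2⟩ := h.exists_functional (x - y)
  have h3 := onesided h hn hDo hDc hG hae hx hy φ h1 h2
  have h4 := h2 ((x - y) - ε • (G x - G y))
  rw [map_sub φ (x - y), map_smul, smul_eq_mul, h1] at h4
  have := mul_le_mul_of_nonneg_left h3 hε
  linarith

/-- Gronwall estimate for the difference of two (perturbed) trajectories. -/
lemma norm_gronwall {n : ℕ} {N : (Fin n → ℝ) → ℝ} (h : IsVecNorm N)
    {D : Set (Fin n → ℝ)} {G : (Fin n → ℝ) → (Fin n → ℝ)} (hGc : ContinuousOn G D)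
    (hDo : IsOpen D) {L : ℝ}
    (hacc : ∀ x y, x ∈ D → y ∈ D → ∀ ε : ℝ, 0 ≤ ε →
      (1 - L * ε) * N (x - y) ≤ N ((x - y) - ε • (G x - G y)))
    {x y p : ℝ → (Fin n → ℝ)} {b δ ε : ℝ}
    (hx : Continuous x) (hy : Continuous y)
    (hxD : ∀ t ∈ Ico 0 b, x t ∈ D) (hyD : ∀ t ∈ Ico 0 b, y t ∈ D)
    (hd : ∀ t ∈ Ico 0 b, HasDerivWithinAt (fun s => x s - y s) (G (x t) - G (y t) + p t) (Ici t) t)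
    (hp : ∀ t ∈ Ico 0 b, N (p t) ≤ ε) (h0 : N (x 0 - y 0) ≤ δ) :
    ∀ t ∈ Icc 0 b, N (x t - y t) ≤ gronwallBound δ L ε t := by
  intro t ht
  have key := le_gronwallBound_of_liminf_deriv_right_le (f := fun t => N (x t - y t))
    (f' := fun t => L * N (x t - y t) + ε) (δ := δ) (K := L) (ε := ε) (a := 0) (b := b)
    (h.continuous.comp (hx.sub hy)).continuousOn ?_ h0 (fun _ _ => le_rfl) t ht
  · simpa using key
  intro t ht r hr
  apply Eventually.frequently
  set z : ℝ → (Fin n → ℝ) := fun s => x s - y s with hz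
  set w : (Fin n → ℝ) := G (x t) - G (y t) with hw
  have hder := (hd t ht).mono (Ioi_subset_Ici_self)
  have hslope : Tendsto (fun s => (s - t)⁻¹ • (z s - z t)) (𝓝[>] t) (𝓝 (w + p t)) := by
    have := (hasDerivWithinAt_iff_tendsto_slope' (by simp : t ∉ Ioi t)).1 hder
    simpa [slope_fun_def] using this
  have hGx : Tendsto (fun s => G (x s)) (𝓝[>] t) (𝓝 (G (x t))) :=
    ((hGc.continuousAt (hDo.mem_nhds (hxD t ht))).tendsto.comp hx.continuousAt).mono_left
      nhdsWithin_le_nhds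
  have hGy : Tendsto (fun s => G (y s)) (𝓝[>] t) (𝓝 (G (y t))) :=
    ((hGc.continuousAt (hDo.mem_nhds (hyD t ht))).tendsto.comp hy.continuousAt).mono_left
      nhdsWithin_le_nhds
  have hzc : Tendsto (fun s => N (z s)) (𝓝[>] t) (𝓝 (N (z t))) :=
    ((h.continuous.comp (hx.sub hy)).tendsto t).mono_left nhdsWithin_le_nhds
  have hlim : Tendsto (fun s => L * N (z s) +
      N ((s - t)⁻¹ • (z s - z t) - (G (x s) - G (y s)))) (𝓝[>] t)
      (𝓝 (L * N (z t) + N (w + p t - w))) :=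
    (hzc.const_mul L).add ((h.continuous.tendsto _).comp (hslope.sub (hGx.sub hGy)))
  have hlt : L * N (z t) + N (w + p t - w) < r := by
    rw [add_sub_cancel_left]
    have := hp t ht
    simp only [hz]
    linarith
  have hb : ∀ᶠ s in 𝓝[>] t, s < b := nhdsWithin_le_nhds (Iio_mem_nhds ht.2)
  filter_upwards [hlim.eventually_lt_const hlt, self_mem_nhdsWithin, hb] with s hs hst hsb
  refine lt_of_le_of_lt ?_ hs
  simp only [mem_Ioi] at hst
  have hst' : 0 < s - t := by linarith
  have hsI : s ∈ Ico 0 b := ⟨by linarith [ht.1], hsb⟩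
  have ha := hacc (x s) (y s) (hxD s hsI) (hyD s hsI) (s - t) hst'.le
  have e : x s - y s - (s - t) • (G (x s) - G (y s)) =
      z t + (s - t) • ((s - t)⁻¹ • (z s - z t) - (G (x s) - G (y s))) := by
    rw [smul_sub (s - t) ((s - t)⁻¹ • (z s - z t)), smul_smul, mul_inv_cancel₀ hst'.ne', one_smul]
    simp only [hz]
    abel
  rw [e] at ha
  have hb2 := h.add_le (z t) ((s - t) • ((s - t)⁻¹ • (z s - z t) - (G (x s) - G (y s))))
  rw [h.smul_eq, abs_of_pos hst'] at hb2
  rw [inv_mul_le_iff₀ hst']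
  have e3 : N (x s - y s) = N (z s) := rfl
  rw [e3] at ha
  linarith

lemma first_exit {u : ℝ → ℝ} (hu : Continuous u) {M T : ℝ}
    (step : ∀ τ ∈ Icc 0 T, (∀ s ∈ Ico 0 τ, u s < M) → u τ < M) :
    ∀ s ∈ Icc 0 T, u s < M := by
  by_contra hcon
  push Not at hcon
  obtain ⟨s, hs, hsM⟩ := hcon
  let S : Set ℝ := Icc 0 T ∩ {s | M ≤ u s}
  have hS : IsCompact S := isCompact_Icc.inter_right (isClosed_le continuous_const hu)
  have hne : S.Nonempty := ⟨s, hs, hsM⟩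
  have hmem := hS.sInf_mem hne
  have hlow : ∀ s ∈ S, sInf S ≤ s := fun s hs => csInf_le hS.bddBelow hs
  have := step (sInf S) hmem.1 (by
    intro s hs
    by_contra hc
    push Not at hc
    have := hlow s ⟨⟨hs.1, hs.2.le.trans hmem.1.2⟩, hc⟩
    linarith [hs.2])
  have h2 : M ≤ u (sInf S) := hmem.2
  linarith

lemma integral_exp_mul' (d t : ℝ) (hd : d ≠ 0) :
    (∫ s in (0:ℝ)..t, Real.exp (d * s)) = (Real.exp (d * t) - 1) / d := by
  rw [intervalIntegral.integral_comp_mul_left (fun s => Real.exp s) hd, integral_exp]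
  simp [smul_eq_mul, inv_mul_eq_div]

lemma gronwall_nu (d₁ d₂ Q t : ℝ) : gronwallBound 0 d₁ (d₂ * Q) t = nu d₁ d₂ t * Q := by
  unfold nu
  by_cases h : d₁ = 0
  · subst h
    simp [gronwallBound_K0]
    ring
  · rw [gronwallBound_of_K_ne_0 h, integral_exp_mul' d₁ t h]
    field_simp
    ring

lemma nu_mono (d₁ d₂ : ℝ) (hd₂ : 0 < d₂) {a b : ℝ} (hab : a ≤ b) : nu d₁ d₂ a ≤ nu d₁ d₂ b := by
  unfold nu
  apply mul_le_mul_of_nonneg_left _ hd₂.le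
  have hi : ∀ a b : ℝ, IntervalIntegrable (fun s => Real.exp (d₁ * s)) volume a b := fun a b =>
    (by fun_prop : Continuous (fun s => Real.exp (d₁ * s))).intervalIntegrable a b
  have := intervalIntegral.integral_add_adjacent_intervals (hi 0 a) (hi a b)
  have h2 : 0 ≤ ∫ s in a..b, Real.exp (d₁ * s) :=
    intervalIntegral.integral_nonneg hab (fun s _ => (Real.exp_pos _).le)
  linarith

lemma gronwall_cl (δ c s t : ℝ) (hc : 0 < c) :
    gronwallBound δ (-c) (c * s * δ) t = (Real.exp (-c * t) * (1 - s) + s) * δ := by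
  rw [gronwallBound_of_K_ne_0 (by linarith)]
  field_simp
  ring

lemma wnorm_top {n : ℕ} (θ x : Fin n → ℝ) : wnorm ⊤ θ x = ⨆ i, |θ i * x i| := by
  unfold wnorm
  rw [PiLp.norm_eq_ciSup]
  rfl

lemma wnorm_mono {n : ℕ} (hn : 0 < n) (r : ℝ≥0∞) (hr : 1 ≤ r) (θ x y : Fin n → ℝ) (k : ℝ)
    (hk : 0 ≤ k) (hxy : ∀ i, |x i| ≤ k * |y i|) : wnorm r θ x ≤ k * wnorm r θ y := by
  have : Nonempty (Fin n) := ⟨⟨0, hn⟩⟩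
  have hxy' : ∀ i, |θ i * x i| ≤ k * |θ i * y i| := by
    intro i
    rw [abs_mul, abs_mul]
    have := mul_le_mul_of_nonneg_left (hxy i) (abs_nonneg (θ i))
    linarith
  rcases eq_or_ne r ⊤ with h | h
  · subst h
    rw [wnorm_top, wnorm_top]
    apply ciSup_le
    intro i
    refine (hxy' i).trans (mul_le_mul_of_nonneg_left ?_ hk)
    exact le_ciSup (f := fun i => |θ i * y i|) (Set.finite_range _).bddAbove i
  · have hr0 : 0 < r.toReal := ENNReal.toReal_pos (by positivity) h
    unfold wnorm
    rw [PiLp.norm_eq_sum hr0, PiLp.norm_eq_sum hr0]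
    have e : k = (k ^ r.toReal) ^ (1 / r.toReal) := by
      rw [← Real.rpow_mul hk, mul_one_div_cancel hr0.ne', Real.rpow_one]
    conv_rhs => rw [e]
    rw [← Real.mul_rpow (by positivity) (Finset.sum_nonneg fun i _ => by positivity),
      Finset.mul_sum]
    apply Real.rpow_le_rpow (Finset.sum_nonneg fun i _ => by positivity) _ (by positivity)
    apply Finset.sum_le_sum
    intro i _
    rw [← Real.mul_rpow hk (norm_nonneg _)]
    apply Real.rpow_le_rpow (norm_nonneg _) _ hr0.le
    exact hxy' i

lemma quant_coord {ρ χ z Q : ℝ} (hρ : 0 < ρ ∧ ρ < 1) (hχ : 0 < χ) (hz : 0 < z)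
    (hQ : ∀ j : ℤ, ρ ^ (j + 1) * χ ≤ z → z < ρ ^ j * χ →
      Q = (ρ ^ j * χ + ρ ^ (j + 1) * χ) / 2) :
    0 < Q ∧ |Q - z| ≤ (1 - ρ) / (1 + ρ) * Q ∧ Q ≤ (1 + ρ) / (2 * ρ) * z ∧
      (z < χ → Q ≤ (1 + ρ) / 2 * χ) := by
  obtain ⟨hρ0, hρ1⟩ := hρ
  obtain ⟨k, hk1, hk2⟩ := exists_mem_Ico_zpow (div_pos hz hχ) ((one_lt_inv₀ hρ0).2 hρ1)
  have h1 : ρ ^ (-(k + 1) + 1) * χ ≤ z := by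
    rw [le_div_iff₀ hχ, inv_zpow'] at hk1
    rwa [show -(k + 1) + 1 = -k by ring]
  have h2 : z < ρ ^ (-(k + 1)) * χ := by
    rwa [div_lt_iff₀ hχ, inv_zpow'] at hk2
  set j := -(k + 1)
  have hQ' := hQ j h1 h2
  have hpj : 0 < ρ ^ j := zpow_pos hρ0 j
  have hsucc : ρ ^ (j + 1) = ρ * ρ ^ j := by rw [zpow_add_one₀ hρ0.ne', mul_comm]
  rw [hsucc] at hQ' h1
  have hA : 0 < ρ ^ j * χ := mul_pos hpj hχ
  have hQA : Q = (1 + ρ) / 2 * (ρ ^ j * χ) := by rw [hQ']; ring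
  have h1' : ρ * (ρ ^ j * χ) ≤ z := by rw [← mul_assoc]; exact h1
  refine ⟨?_, ?_, ?_, ?_⟩
  · rw [hQA]; positivity
  · have : (1 - ρ) / (1 + ρ) * Q = (1 - ρ) / 2 * (ρ ^ j * χ) := by
      rw [hQA]; field_simp
    rw [this, hQA, abs_le]
    constructor <;> nlinarith
  · rw [hQA]
    calc (1 + ρ) / 2 * (ρ ^ j * χ) = (1 + ρ) / (2 * ρ) * (ρ * (ρ ^ j * χ)) := by field_simp
      _ ≤ _ := mul_le_mul_of_nonneg_left h1' (by positivity)
  · intro hzχ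
    rw [hQA]
    apply mul_le_mul_of_nonneg_left _ (by positivity)
    have hlt : ρ ^ (j + 1) < ρ ^ (0:ℤ) := by
      rw [hsucc, zpow_zero]
      by_contra hc
      push Not at hc
      have : χ ≤ ρ * ρ ^ j * χ := le_mul_of_one_le_left hχ.le hc
      linarith
    have hj : 0 < j + 1 := (zpow_lt_zpow_iff_right_of_lt_one₀ hρ0 hρ1).1 hlt
    have : ρ ^ j ≤ ρ ^ (0:ℤ) := (zpow_le_zpow_iff_right_of_lt_one₀ hρ0 hρ1).2 (by omega)
    rw [zpow_zero] at this
    nlinarith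

lemma ode_exists {n : ℕ} (F : (Fin n → ℝ) → (Fin n → ℝ)) (K : NNReal) (hF : LipschitzWith K F)
    (M : ℝ) (hM : 0 ≤ M) (hb : ∀ x, ‖F x‖ ≤ M) (p : Fin n → ℝ) (T : ℝ) (hT : 0 < T) :
    ∃ y : ℝ → (Fin n → ℝ), Continuous y ∧ y 0 = p ∧
      ∀ s ∈ Ico 0 T, HasDerivWithinAt y (F (y s)) (Ici s) s := by
  have hPL : IsPicardLindelof (fun _ : ℝ => F) (⟨0, le_rfl, hT.le⟩ : Icc 0 T) p
      (Real.toNNReal (M * T)) 0 (Real.toNNReal M) K := by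
    apply IsPicardLindelof.of_time_independent
    · intro x _
      rw [Real.coe_toNNReal M hM]
      exact hb x
    · exact hF.lipschitzOnWith
    · rw [Real.coe_toNNReal M hM, Real.coe_toNNReal _ (by positivity)]
      simp [max_eq_left hT.le]
  obtain ⟨a, ha0, ha⟩ := hPL.exists_eq_forall_mem_Icc_hasDerivWithinAt₀
  have hac : ContinuousOn a (Icc 0 T) := fun t ht => (ha t ht).continuousWithinAt
  refine ⟨fun s => a (projIcc 0 T hT.le s), ?_, ?_, ?_⟩
  · have : Continuous ((Icc 0 T).domRestrict a) := continuousOn_iff_continuous_domRestrict.1 hac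
    exact this.comp continuous_projIcc
  · simpa [projIcc_left] using ha0
  · intro s hs
    have hs' : s ∈ Icc 0 T := ⟨hs.1, hs.2.le⟩
    have e : ∀ u ∈ Icc 0 T, a (projIcc 0 T hT.le u) = a u := by
      intro u hu
      rw [projIcc_of_mem _ hu]
    simp only [e s hs']
    have h1 : HasDerivWithinAt a (F (a s)) (Ici s) s := by
      have h2 := (ha s hs').mono  (Icc_subset_Icc_left hs.1)
      exact h2.mono_of_mem_nhdsWithin (Icc_mem_nhdsGE hs.2)
    refine h1.congr_of_eventuallyEq ?_ (e s hs')
    filter_upwards [Icc_mem_nhdsGE hs.2] with u hu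
    exact e u ⟨hs.1.trans hu.1, hu.2⟩

lemma ode_exists2 {n : ℕ} {C : Set (Fin n → ℝ)} (hC : IsCompact C)
    {G : (Fin n → ℝ) → (Fin n → ℝ)} (hG : LocallyLipschitzOn C G) (p : Fin n → ℝ)
    (T : ℝ) (hT : 0 < T) :
    ∃ y : ℝ → (Fin n → ℝ), Continuous y ∧ y 0 = p ∧
      ∀ s ∈ Ico 0 T, y s ∈ C → HasDerivWithinAt y (G (y s)) (Ici s) s := by
  obtain ⟨K, hK⟩ := hG.exists_lipschitzOnWith_of_compact hC
  obtain ⟨g, hg, hgG⟩ := hK.extend_pi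
  obtain ⟨M, hM⟩ := hC.exists_bound_of_continuousOn hG.continuousOn
  set M' := max M 0 with hM'
  let F : (Fin n → ℝ) → (Fin n → ℝ) := fun x i => max (-M') (min M' (g x i))
  have hM0 : 0 ≤ M' := le_max_right _ _
  have hF : LipschitzWith K F := by
    apply LipschitzWith.of_dist_le_mul
    intro x y
    rw [dist_pi_le_iff (by positivity)]
    intro i
    have h1 : LipschitzWith K (fun x => g x i) := by
      have h0 := (LipschitzWith.eval (α := fun _ : Fin n => ℝ) i).comp hg
      rw [one_mul] at h0
      exact h0
    exact ((h1.const_min M').const_max (-M')).dist_le_mul x y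
  have hb : ∀ x, ‖F x‖ ≤ M' := by
    intro x
    rw [pi_norm_le_iff_of_nonneg hM0]
    intro i
    rw [Real.norm_eq_abs, abs_le]
    exact ⟨le_max_left _ _, max_le (by linarith) (min_le_left _ _)⟩
  have hFG : ∀ x ∈ C, F x = G x := by
    intro x hx
    ext i
    have h1 : |G x i| ≤ M' := (norm_le_pi_norm (G x) i).trans ((hM x hx).trans (le_max_left _ _))
    rw [abs_le] at h1
    simp only [F, ← hgG hx]
    rw [min_eq_right h1.2, max_eq_right h1.1]
  obtain ⟨y, hy, hy0, hyd⟩ := ode_exists F K hF M' hM0 hb p T hT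
  refine ⟨y, hy, hy0, fun s hs hsC => ?_⟩
  rw [← hFG _ hsC]
  exact hyd s hs

lemma hasDeriv_shift {n : ℕ} {y : ℝ → (Fin n → ℝ)} {v : Fin n → ℝ} {a s : ℝ}
    (h : HasDerivWithinAt y v (Ici (s - a)) (s - a)) :
    HasDerivWithinAt (fun u => y (u - a)) v (Ici s) s := by
  have h1 : HasDerivWithinAt (fun u : ℝ => u - a) 1 (Ici s) s :=
    ((hasDerivAt_id s).sub_const a).hasDerivWithinAt
  have h2 := HasDerivWithinAt.scomp (h := fun u : ℝ => u - a) (h' := 1) (g₁ := y) (g₁' := v) s h h1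
    (by intro u hu; simp only [mem_Ici] at *; linarith)
  rw [one_smul] at h2
  exact h2

lemma hasDeriv_shift' {n : ℕ} {y : ℝ → (Fin n → ℝ)} {v : Fin n → ℝ} {a s : ℝ}
    (h : HasDerivWithinAt y v (Ici (a + s)) (a + s)) :
    HasDerivWithinAt (fun u => y (a + u)) v (Ici s) s := by
  have h' : HasDerivWithinAt y v (Ici (s - (-a))) (s - (-a)) := by
    rwa [show s - -a = a + s by ring]
  have := hasDeriv_shift h'
  simpa [add_comm, sub_neg_eq_add] using this

lemma t_lower {t : ℕ → ℝ} {δ : ℝ} (h0 : t 0 = 0) (hs : ∀ k, δ ≤ t (k + 1) - t k) (k : ℕ) :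
    k * δ ≤ t k := by
  induction k with
  | zero => simp [h0]
  | succ k ih =>
    push_cast
    have := hs k
    linarith

lemma exists_t_gt {t : ℕ → ℝ} {δ : ℝ} (hδ : 0 < δ) (h0 : t 0 = 0)
    (hs : ∀ k, δ ≤ t (k + 1) - t k) (s : ℝ) : ∃ k, s < t k := by
  obtain ⟨k, hk⟩ := exists_nat_gt (s / δ)
  refine ⟨k, ?_⟩
  rw [div_lt_iff₀ hδ] at hk
  exact hk.trans_le (t_lower h0 hs k)

lemma glue {n : ℕ} (N : (Fin n → ℝ) → ℝ) (P : (Fin n → ℝ) → Prop)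
    (Q : (Fin n → ℝ) → (Fin n → ℝ)) (V : (Fin n → ℝ) → (Fin n → ℝ) → (Fin n → ℝ))
    (τ : (Fin n → ℝ) → ℝ) (δ γ : ℝ) (hδ : 0 < δ)
    (hstep : ∀ p, P p → δ ≤ τ (Q p) ∧ ∃ y : ℝ → (Fin n → ℝ), Continuous y ∧ y 0 = p ∧
      (∀ s ∈ Ico 0 (τ (Q p)), HasDerivWithinAt y (V (Q p) (y s)) (Ici s) s) ∧
      (∀ s ∈ Icc 0 (τ (Q p)), N (y s) ≤ Real.exp (-γ * s) * N p ∧ P (y s)))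
    (x₀ : Fin n → ℝ) (hx₀ : P x₀) :
    ∃ (x : ℝ → (Fin n → ℝ)) (t : ℕ → ℝ) (q : ℕ → (Fin n → ℝ)),
      (t 0 = 0 ∧ x 0 = x₀ ∧ Continuous x ∧ (∀ k, q k = Q (x (t k))) ∧
        (∀ k, t (k + 1) = t k + τ (q k)) ∧
        (∀ k, ∀ s ∈ Ico (t k) (t (k + 1)), HasDerivWithinAt x (V (q k) (x s)) (Ici s) s)) ∧
      (∀ k, δ ≤ t (k + 1) - t k) ∧ (∀ k, P (x (t k))) ∧
      (∀ s, 0 ≤ s → N (x s) ≤ Real.exp (-γ * s) * N x₀) := by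
  have hτ : ∀ p, P p → δ ≤ τ (Q p) := fun p hp => (hstep p hp).1
  have hstep' : ∀ p, ∃ y : ℝ → (Fin n → ℝ), P p → Continuous y ∧ y 0 = p ∧
      (∀ s ∈ Ico 0 (τ (Q p)), HasDerivWithinAt y (V (Q p) (y s)) (Ici s) s) ∧
      (∀ s ∈ Icc 0 (τ (Q p)), N (y s) ≤ Real.exp (-γ * s) * N p ∧ P (y s)) := by
    intro p
    by_cases hp : P p
    · obtain ⟨y, hy⟩ := (hstep p hp).2
      exact ⟨y, fun _ => hy⟩
    · exact ⟨fun _ => p, fun h => absurd h hp⟩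
  choose Y hY using hstep'
  let p : ℕ → (Fin n → ℝ) := fun k => Nat.rec x₀ (fun _ z => Y z (τ (Q z))) k
  have p0 : p 0 = x₀ := rfl
  have pS : ∀ k, p (k + 1) = Y (p k) (τ (Q (p k))) := fun k => rfl
  have hP : ∀ k, P (p k) := by
    intro k
    induction k with
    | zero => exact hx₀
    | succ k ih =>
      rw [pS]
      exact ((hY _ ih).2.2.2 _ ⟨hδ.le.trans (hτ _ ih), le_rfl⟩).2
  let t : ℕ → ℝ := fun k => ∑ i ∈ Finset.range k, τ (Q (p i))
  have t0 : t 0 = 0 := by simp [t]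
  have tS : ∀ k, t (k + 1) = t k + τ (Q (p k)) := fun k => Finset.sum_range_succ _ _
  have hgap : ∀ k, δ ≤ t (k + 1) - t k := by
    intro k
    rw [tS]
    have := hτ _ (hP k)
    linarith
  have htmono : Monotone t := monotone_nat_of_le_succ (fun k => by have := hgap k; linarith)
  let Z : ℕ → ℝ → (Fin n → ℝ) := fun k => Nat.rec (fun _ => x₀)
    (fun k z s => if s ≤ t k then z s else Y (p k) (s - t k)) k
  have Z0 : Z 0 = fun _ => x₀ := rfl
  have ZS : ∀ k s, Z (k + 1) s = if s ≤ t k then Z k s else Y (p k) (s - t k) := fun k s => rfl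
  have Zt : ∀ k, Z k (t k) = p k := by
    intro k
    cases k with
    | zero => rfl
    | succ k =>
      have h1 := hgap k
      rw [ZS, if_neg (by linarith), pS, tS, add_sub_cancel_left]
  have Zc : ∀ k, Continuous (Z k) := by
    intro k
    induction k with
    | zero => exact continuous_const
    | succ k ih =>
      have : Z (k + 1) = fun s => if s ≤ t k then Z k s else Y (p k) (s - t k) := funext (ZS k)
      rw [this]
      refine Continuous.if_le ih ((hY _ (hP k)).1.comp (continuous_id.sub continuous_const))
        continuous_id continuous_const ?_
      rintro s rfl
      rw [Zt]
      simp [(hY _ (hP k)).2.1]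
  have Zeq : ∀ k j s, s ≤ t k → Z (k + j) s = Z k s := by
    intro k j s hs
    induction j with
    | zero => rfl
    | succ j ih =>
      rw [← add_assoc, ZS, if_pos (hs.trans (htmono (Nat.le_add_right k j))), ih]
  choose K hK using exists_t_gt hδ t0 hgap
  let x : ℝ → (Fin n → ℝ) := fun s => Z (K s) s
  have hx : ∀ k s, s ≤ t k → x s = Z k s := by
    intro k s hs
    rcases le_total k (K s) with h | h
    · obtain ⟨j, hj⟩ := Nat.exists_eq_add_of_le h
      simp only [x]
      rw [hj, Zeq k j s hs]
    · obtain ⟨j, hj⟩ := Nat.exists_eq_add_of_le h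
      rw [hj, Zeq (K s) j s (hK s).le]
  have hxt : ∀ k, x (t k) = p k := fun k => by rw [hx k _ le_rfl, Zt]
  have hxY : ∀ k s, t k ≤ s → s ≤ t (k + 1) → x s = Y (p k) (s - t k) := by
    intro k s h1 h2
    rcases h1.eq_or_lt with h | h
    · subst h
      rw [hxt, sub_self, (hY _ (hP k)).2.1]
    · rw [hx (k + 1) s h2, ZS, if_neg (by linarith)]
  refine ⟨x, t, fun k => Q (p k), ⟨t0, ?_, ?_, ?_, tS, ?_⟩, hgap, ?_, ?_⟩
  · have := hxt 0
    rwa [t0, p0] at this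
  · rw [continuous_iff_continuousAt]
    intro s
    refine (Zc (K s)).continuousAt.congr ?_
    filter_upwards [Iio_mem_nhds (hK s)] with u hu
    exact (hx _ _ (le_of_lt hu)).symm
  · intro k
    rw [hxt]
  · intro k s hs
    have hY' := (hY _ (hP k)).2.2.1 (s - t k) ⟨by linarith [hs.1], by
      have := hs.2; rw [tS] at this; linarith⟩
    have hd := hasDeriv_shift hY'
    rw [← hxY k s hs.1 hs.2.le] at hd
    refine hd.congr_of_eventuallyEq ?_ (hxY k s hs.1 hs.2.le)
    filter_upwards [Icc_mem_nhdsGE hs.2] with u hu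
    exact hxY k u (hs.1.trans hu.1) hu.2
  · intro k
    rw [hxt]; exact hP k
  · have hall : ∀ k, ∀ s, 0 ≤ s → s ≤ t k → N (x s) ≤ Real.exp (-γ * s) * N x₀ := by
      intro k
      induction k with
      | zero =>
        intro s h0 h1
        rw [t0] at h1
        have : s = 0 := le_antisymm h1 h0
        subst this
        have h2 := hxt 0
        rw [t0, p0] at h2
        simp [h2]
      | succ k ih =>
        intro s h0 h1
        rcases le_total s (t k) with h | h
        · exact ih s h0 h
        · rw [hxY k s h h1]
          have ht0 : 0 ≤ t k := by rw [← t0]; exact htmono (Nat.zero_le k)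
          have h2 := ih (t k) ht0 le_rfl
          rw [hxt] at h2
          have h3 := ((hY _ (hP k)).2.2.2 (s - t k) ⟨by linarith, by
            rw [tS] at h1; linarith⟩).1
          refine h3.trans ((mul_le_mul_of_nonneg_left h2 (Real.exp_pos _).le).trans ?_)
          rw [← mul_assoc, ← Real.exp_add]
          apply le_of_eq
          ring_nf
    intro s hs
    exact hall (K s) s hs (hK s).le

lemma glue_unique {n : ℕ} (P : (Fin n → ℝ) → Prop)
    (Q : (Fin n → ℝ) → (Fin n → ℝ)) (V : (Fin n → ℝ) → (Fin n → ℝ) → (Fin n → ℝ))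
    (τ : (Fin n → ℝ) → ℝ) (δ : ℝ) (hδ : 0 < δ)
    (huniq : ∀ p, P p → ∀ y y' : ℝ → (Fin n → ℝ), Continuous y → Continuous y' →
      y 0 = p → y' 0 = p →
      (∀ s ∈ Ico 0 (τ (Q p)), HasDerivWithinAt y (V (Q p) (y s)) (Ici s) s) →
      (∀ s ∈ Ico 0 (τ (Q p)), HasDerivWithinAt y' (V (Q p) (y' s)) (Ici s) s) →
      ∀ s ∈ Icc 0 (τ (Q p)), y' s = y s)
    (x₀ : Fin n → ℝ)
    (x : ℝ → (Fin n → ℝ)) (t : ℕ → ℝ) (q : ℕ → (Fin n → ℝ))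
    (h : t 0 = 0 ∧ x 0 = x₀ ∧ Continuous x ∧ (∀ k, q k = Q (x (t k))) ∧
        (∀ k, t (k + 1) = t k + τ (q k)) ∧
        (∀ k, ∀ s ∈ Ico (t k) (t (k + 1)), HasDerivWithinAt x (V (q k) (x s)) (Ici s) s))
    (hgap : ∀ k, δ ≤ t (k + 1) - t k) (hP : ∀ k, P (x (t k)))
    (x' : ℝ → (Fin n → ℝ)) (t' : ℕ → ℝ) (q' : ℕ → (Fin n → ℝ))
    (h' : t' 0 = 0 ∧ x' 0 = x₀ ∧ Continuous x' ∧ (∀ k, q' k = Q (x' (t' k))) ∧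
        (∀ k, t' (k + 1) = t' k + τ (q' k)) ∧
        (∀ k, ∀ s ∈ Ico (t' k) (t' (k + 1)), HasDerivWithinAt x' (V (q' k) (x' s)) (Ici s) s)) :
    ∀ s, 0 ≤ s → x' s = x s := by
  obtain ⟨t0, x0, xc, hq, ht, hd⟩ := h
  obtain ⟨t0', x0', xc', hq', ht', hd'⟩ := h'
  have htmono : Monotone t := monotone_nat_of_le_succ (fun k => by have := hgap k; linarith)
  have hall : ∀ k, t' k = t k ∧ ∀ s, 0 ≤ s → s ≤ t k → x' s = x s := by
    intro k
    induction k with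
    | zero =>
      refine ⟨by rw [t0, t0'], fun s h0 h1 => ?_⟩
      rw [t0] at h1
      have : s = 0 := le_antisymm h1 h0
      subst this
      rw [x0, x0']
    | succ k ih =>
      obtain ⟨ih1, ih2⟩ := ih
      have htk : 0 ≤ t k := by rw [← t0]; exact htmono (Nat.zero_le k)
      have hxk := ih2 (t k) htk le_rfl
      have hqk : q' k = q k := by rw [hq', hq, ih1, hxk]
      have htS : t' (k + 1) = t (k + 1) := by rw [ht', ht, ih1, hqk]
      refine ⟨htS, fun s h0 h1 => ?_⟩
      rcases le_total s (t k) with h | h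
      · exact ih2 s h0 h
      · have := huniq (x (t k)) (hP k) (fun u => x (t k + u)) (fun u => x' (t k + u))
          (xc.comp (continuous_const.add continuous_id))
          (xc'.comp (continuous_const.add continuous_id)) (by simp) (by simp [hxk])
          (by
            intro u hu
            rw [← hq k] at hu ⊢
            apply hasDeriv_shift'
            apply hd k
            rw [ht k]
            exact ⟨by linarith [hu.1], by linarith [hu.2]⟩)
          (by
            intro u hu
            rw [← hq k] at hu ⊢
            apply hasDeriv_shift'
            rw [← hqk]
            apply hd' k
            rw [htS, ht k, ih1]
            exact ⟨by linarith [hu.1], by linarith [hu.2]⟩)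
          (s - t k) ⟨by linarith, by rw [← hq k]; rw [ht k] at h1; linarith⟩
        simpa using this
  intro s hs
  obtain ⟨k, hk⟩ := exists_t_gt hδ t0 hgap s
  exact (hall k).2 s hs hk.le

section tau
variable {n : ℕ} {Ncl Nop : (Fin n → ℝ) → ℝ} {R₂ τmax σ d₁ Lop ρ : ℝ}
  {X : (Fin n → ℝ) → ℝ → (Fin n → ℝ)} {q : Fin n → ℝ}

lemma tauTilde_le : tauTilde Nop R₂ τmax X q ≤ τmax := by
  unfold tauTilde
  split_ifs with h
  · exact le_rfl
  · push Not at h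
    obtain ⟨s, hs, hs2⟩ := h
    exact (csInf_le (s := {s : ℝ | 0 < s ∧ R₂ ≤ Nop (X q s)})
      ⟨0, fun _ hu => hu.1.le⟩ ⟨hs.1, hs2⟩).trans hs.2.le

lemma tauSamp_le : tauSamp Ncl Nop R₂ τmax σ d₁ Lop ρ X q ≤ tauTilde Nop R₂ τmax X q := by
  unfold tauSamp
  split_ifs with h
  · exact le_rfl
  · push Not at h
    obtain ⟨s, hs, hs2⟩ := h
    exact (csInf_le (s := {s : ℝ | 0 < s ∧ σ * Ncl q < psiLog Nop d₁ Lop ρ X s q})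
      ⟨0, fun _ hu => hu.1.le⟩ ⟨hs.1, hs2⟩).trans hs.2.le

lemma lt_of_lt_tauTilde {s : ℝ} (hs0 : 0 < s) (hs : s < tauTilde Nop R₂ τmax X q) :
    Nop (X q s) < R₂ := by
  unfold tauTilde at hs
  split_ifs at hs with h
  · exact h s ⟨hs0, hs⟩
  · by_contra hc
    push Not at hc
    have := csInf_le (s := {s : ℝ | 0 < s ∧ R₂ ≤ Nop (X q s)}) ⟨0, fun _ hu => hu.1.le⟩ ⟨hs0, hc⟩
    linarith

lemma psi_le_of_lt_tauSamp {s : ℝ} (hs0 : 0 < s)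
    (hs : s < tauSamp Ncl Nop R₂ τmax σ d₁ Lop ρ X q) :
    psiLog Nop d₁ Lop ρ X s q ≤ σ * Ncl q := by
  unfold tauSamp at hs
  split_ifs at hs with h
  · exact h s ⟨hs0, hs⟩
  · by_contra hc
    push Not at hc
    have := csInf_le (s := {s : ℝ | 0 < s ∧ σ * Ncl q < psiLog Nop d₁ Lop ρ X s q})
      ⟨0, fun _ hu => hu.1.le⟩ ⟨hs0, hc⟩
    linarith

lemma le_tauSamp {a b : ℝ} (ha : ∀ s, 0 ≤ s → s ≤ a → Nop (X q s) < R₂)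
    (hb : ∀ s, 0 ≤ s → s ≤ a → s ≤ b → psiLog Nop d₁ Lop ρ X s q ≤ σ * Ncl q) :
    min τmax (min b a) ≤ tauSamp Ncl Nop R₂ τmax σ d₁ Lop ρ X q := by
  have h1 : min τmax (min b a) ≤ tauTilde Nop R₂ τmax X q := by
    unfold tauTilde
    split_ifs with h
    · exact min_le_left _ _
    · push Not at h
      obtain ⟨s, hs, hs2⟩ := h
      refine le_csInf (s := {s : ℝ | 0 < s ∧ R₂ ≤ Nop (X q s)}) ⟨s, hs.1, hs2⟩ ?_
      intro u hu
      by_contra hc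
      push Not at hc
      have := ha u hu.1.le (hc.le.trans ((min_le_right _ _).trans (min_le_right _ _)))
      linarith [hu.2]
  unfold tauSamp
  split_ifs with h
  · exact h1
  · push Not at h
    obtain ⟨s, hs, hs2⟩ := h
    refine le_csInf (s := {s : ℝ | 0 < s ∧ σ * Ncl q < psiLog Nop d₁ Lop ρ X s q}) ⟨s, hs.1, hs2⟩ ?_
    intro u hu
    by_contra hc
    push Not at hc
    have := hb u hu.1.le (hc.le.trans ((min_le_right _ _).trans (min_le_right _ _)))
      (hc.le.trans ((min_le_right _ _).trans (min_le_left _ _)))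
    linarith [hu.2]

end tau

lemma exp_decay {c s t T γ : ℝ} (hs : 0 < s ∧ s < 1) (hT : 0 < T) (ht : 0 ≤ t ∧ t ≤ T)
    (hγ : γ = -(1 / T) * Real.log (Real.exp (-c * T) * (1 - s) + s)) :
    Real.exp (-c * t) * (1 - s) + s ≤ Real.exp (-γ * t) := by
  have hB : 0 < Real.exp (-c * T) * (1 - s) + s := by
    have := mul_pos (Real.exp_pos (-c * T)) (by linarith [hs.2] : 0 < 1 - s)
    linarith [hs.1]
  have e : Real.exp (-γ * t) = (Real.exp (-c * T) * (1 - s) + s) ^ (t / T) := by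
    rw [Real.rpow_def_of_pos hB, hγ]
    congr 1
    field_simp
  have hc := Real.concaveOn_rpow (p := t / T) (div_nonneg ht.1 hT.le) ((div_le_one hT).2 ht.2)
  have h2 := hc.2 (show Real.exp (-c * T) ∈ Ici (0:ℝ) from (Real.exp_pos _).le)
    (show (1:ℝ) ∈ Ici (0:ℝ) from by simp) (by linarith [hs.2] : (0:ℝ) ≤ 1 - s) hs.1.le (by ring)
  simp only [smul_eq_mul, Real.one_rpow, mul_one] at h2
  rw [e]
  have e2 : Real.exp (-c * T) ^ (t / T) = Real.exp (-c * t) := by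
    rw [← Real.exp_mul]
    congr 1
    field_simp
  rw [e2] at h2
  rw [mul_comm, mul_comm (Real.exp (-c * T))]
  exact h2

lemma gamma_pos {c s T γ : ℝ} (hc : 0 < c) (hs : 0 < s ∧ s < 1) (hT : 0 < T)
    (hγ : γ = -(1 / T) * Real.log (Real.exp (-c * T) * (1 - s) + s)) : 0 < γ := by
  have h1 : Real.exp (-c * T) < 1 := by
    rw [Real.exp_lt_one_iff]
    nlinarith
  have h0 := Real.exp_pos (-c * T)
  have hlog : Real.log (Real.exp (-c * T) * (1 - s) + s) < 0 := by
    apply Real.log_neg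
    · nlinarith [hs.1, hs.2]
    · nlinarith [hs.1, hs.2]
  rw [hγ]
  have : 0 < 1 / T := by positivity
  nlinarith

lemma quant_vec {n : ℕ} {ρ χ₀ : ℝ} {θcl : Fin n → ℝ} (hρ : 0 < ρ ∧ ρ < 1) (hχ₀pos : 0 < χ₀)
    (hθcl : ∀ i, 0 < θcl i)
    (Qlog : (Fin n → ℝ) → (Fin n → ℝ))
    (hQ0 : ∀ (x : Fin n → ℝ) (i : Fin n), x i = 0 → Qlog x i = 0)
    (hQpos : ∀ (x : Fin n → ℝ) (i : Fin n) (j : ℤ),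
      ρ ^ (j + 1) * (χ₀ / θcl i) ≤ x i → x i < ρ ^ j * (χ₀ / θcl i) →
      Qlog x i = (ρ ^ j * (χ₀ / θcl i) + ρ ^ (j + 1) * (χ₀ / θcl i)) / 2)
    (hQneg : ∀ (x : Fin n → ℝ) (i : Fin n), x i < 0 → Qlog x i = - Qlog (-x) i)
    (x : Fin n → ℝ) (i : Fin n) :
    |Qlog x i - x i| ≤ (1 - ρ) / (1 + ρ) * |Qlog x i| ∧ |Qlog x i| ≤ (1 + ρ) / (2 * ρ) * |x i| ∧
      (|x i| < χ₀ / θcl i → |Qlog x i| ≤ (1 + ρ) / 2 * (χ₀ / θcl i)) := by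
  have hχ : 0 < χ₀ / θcl i := div_pos hχ₀pos (hθcl i)
  rcases lt_trichotomy (x i) 0 with h | h | h
  · have h' : 0 < (-x) i := by simpa using h
    obtain ⟨a1, a2, a3, a4⟩ := quant_coord hρ hχ h' (fun j => hQpos (-x) i j)
    have e := hQneg x i h
    have e1 : |Qlog x i| = Qlog (-x) i := by rw [e, abs_neg, abs_of_pos a1]
    have e2 : |x i| = (-x) i := by rw [abs_of_neg h]; rfl
    have e3 : |Qlog x i - x i| = |Qlog (-x) i - (-x) i| := by
      rw [e, ← abs_neg]
      congr 1
      simp only [Pi.neg_apply]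
      ring
    rw [e1, e2, e3]
    exact ⟨a2, a3, a4⟩
  · rw [hQ0 x i h, h]
    have : 0 ≤ (1 + ρ) / 2 * (χ₀ / θcl i) := mul_nonneg (by linarith [hρ.1]) hχ.le
    simpa using fun _ => this
  · obtain ⟨a1, a2, a3, a4⟩ := quant_coord hρ hχ h (fun j => hQpos x i j)
    rw [abs_of_pos a1, abs_of_pos h]
    exact ⟨a2, a3, a4⟩

lemma llip_cl {n : ℕ} {D : Set (Fin n → ℝ)} {G : (Fin n → ℝ) → (Fin n → ℝ)}
    (hLip : ∀ x ∈ D, ∃ (K : NNReal) (ε : ℝ), 0 < ε ∧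
      LipschitzOnWith K G (Metric.ball x ε ∩ D)) : LocallyLipschitzOn D G := by
  intro x hx
  obtain ⟨K, ε, hε, h⟩ := hLip x hx
  refine ⟨K, Metric.ball x ε ∩ D, ?_, h⟩
  exact Filter.inter_mem (mem_nhdsWithin_of_mem_nhds (Metric.ball_mem_nhds x hε))
    self_mem_nhdsWithin

lemma llip_op {n : ℕ} {D : Set (Fin n → ℝ)} (hD : IsOpen D) {G : (Fin n → ℝ) → (Fin n → ℝ)}
    (hG : ContDiffOn ℝ 1 G D) : LocallyLipschitzOn D G := by
  intro x hx
  have h1 : ContDiffAt ℝ 1 G x := hG.contDiffAt (hD.mem_nhds hx)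
  obtain ⟨K, t, ht, h⟩ := h1.exists_lipschitzOnWith
  exact ⟨K, t, mem_nhdsWithin_of_mem_nhds ht, h⟩

section op
variable {n : ℕ} {Nop : (Fin n → ℝ) → ℝ} {R₂ d₁ d₂ : ℝ} {G : (Fin n → ℝ) → (Fin n → ℝ)}

/-- bound of the predicted trajectory deviation -/
lemma pred_bound (hNop : IsVecNorm Nop) (hGc : ContinuousOn G (nball Nop R₂))
    (hacc : ∀ x y, x ∈ nball Nop R₂ → y ∈ nball Nop R₂ → ∀ ε : ℝ, 0 ≤ ε →
      (1 - d₁ * ε) * Nop (x - y) ≤ Nop ((x - y) - ε • (G x - G y)))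
    {q : Fin n → ℝ} (hq : Nop q < R₂) (hqq : Nop (G q) ≤ d₂ * Nop q)
    {z : ℝ → (Fin n → ℝ)} (hz : Continuous z) (hz0 : z 0 = q)
    (hzd : ∀ s : ℝ, 0 ≤ s → Nop (z s) < R₂ → HasDerivWithinAt z (G (z s)) (Set.Ici 0) s)
    {b : ℝ} (hb : ∀ s ∈ Ico 0 b, Nop (z s) < R₂) :
    ∀ s ∈ Icc 0 b, Nop (z s - q) ≤ nu d₁ d₂ s * Nop q := by
  intro s hs
  rw [← gronwall_nu]
  refine norm_gronwall hNop hGc (hNop.isOpen_nball _) hacc (y := fun _ => q) (p := fun _ => G q)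
    hz continuous_const hb (fun _ _ => hq) ?_ (fun _ _ => hqq) ?_ s hs
  · intro t ht
    have := ((hzd t ht.1 (hb t ht)).mono (Ici_subset_Ici.2 ht.1)).sub_const q
    simpa using this
  · rw [hz0, sub_self, hNop.map_zero]

lemma pred_ball (hNop : IsVecNorm Nop) (hGc : ContinuousOn G (nball Nop R₂)) (hd₂ : 0 < d₂)
    (hacc : ∀ x y, x ∈ nball Nop R₂ → y ∈ nball Nop R₂ → ∀ ε : ℝ, 0 ≤ ε →
      (1 - d₁ * ε) * Nop (x - y) ≤ Nop ((x - y) - ε • (G x - G y)))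
    {q : Fin n → ℝ} (hq : Nop q < R₂) (hqq : Nop (G q) ≤ d₂ * Nop q)
    {z : ℝ → (Fin n → ℝ)} (hz : Continuous z) (hz0 : z 0 = q)
    (hzd : ∀ s : ℝ, 0 ≤ s → Nop (z s) < R₂ → HasDerivWithinAt z (G (z s)) (Set.Ici 0) s)
    {b lam : ℝ} (hlam : lam * (1 + nu d₁ d₂ b) = 1) (hlam0 : 0 < lam) (hql : Nop q < lam * R₂) :
    ∀ s ∈ Icc 0 b, Nop (z s) < R₂ := by
  refine first_exit (u := fun s => Nop (z s)) (hNop.continuous.comp hz) ?_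
  intro τ hτ h
  have h1 := pred_bound hNop hGc hacc hq hqq hz hz0 hzd h τ ⟨hτ.1, le_rfl⟩
  have h2 := nu_mono d₁ d₂ hd₂ hτ.2
  have h3 := hNop.le_add_sub (z τ) q
  have h4 := hNop.nonneg q
  have h5 : 0 < 1 + nu d₁ d₂ b := by
    by_contra hc
    push Not at hc
    nlinarith
  have h6 : (1 + nu d₁ d₂ b) * Nop q < (1 + nu d₁ d₂ b) * (lam * R₂) :=
    mul_lt_mul_of_pos_left hql h5
  have h7 : (1 + nu d₁ d₂ b) * (lam * R₂) = R₂ := by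
    linear_combination R₂ * hlam
  have h8 := mul_le_mul_of_nonneg_right h2 h4
  show Nop (z τ) < R₂
  linarith

/-- two trajectories of the open-loop vector field -/
lemma op_diff (hNop : IsVecNorm Nop) (hGc : ContinuousOn G (nball Nop R₂))
    (hacc : ∀ x y, x ∈ nball Nop R₂ → y ∈ nball Nop R₂ → ∀ ε : ℝ, 0 ≤ ε →
      (1 - d₁ * ε) * Nop (x - y) ≤ Nop ((x - y) - ε • (G x - G y)))
    {z y : ℝ → (Fin n → ℝ)} (hz : Continuous z) (hy : Continuous y) {b : ℝ}
    (hzD : ∀ s ∈ Ico 0 b, Nop (z s) < R₂) (hyD : ∀ s ∈ Ico 0 b, Nop (y s) < R₂)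
    (hzd : ∀ s ∈ Ico 0 b, HasDerivWithinAt z (G (z s)) (Ici s) s)
    (hyd : ∀ s ∈ Ico 0 b, HasDerivWithinAt y (G (y s)) (Ici s) s) :
    ∀ s ∈ Icc 0 b, Nop (z s - y s) ≤ Nop (z 0 - y 0) * Real.exp (d₁ * s) := by
  intro s hs
  rw [← gronwallBound_ε0]
  refine norm_gronwall hNop hGc (hNop.isOpen_nball _) hacc (p := fun _ => 0)
    hz hy hzD hyD ?_ (fun _ _ => by rw [hNop.map_zero]) le_rfl s hs
  intro t ht
  have h := (hzd t ht).sub (hyd t ht)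
  rw [← add_zero (G (z t) - G (y t))] at h
  exact h

end op

/-- a priori estimate for the closed loop between two sampling instants -/
lemma apriori {n m : ℕ} {f : (Fin n → ℝ) → (Fin m → ℝ) → (Fin n → ℝ)}
    {g : (Fin n → ℝ) → (Fin m → ℝ)} (hf0 : f 0 (g 0) = 0)
    {Ncl Nop : (Fin n → ℝ) → ℝ} (hNcl : IsVecNorm Ncl) (hNop : IsVecNorm Nop)
    {c R₁ R₂ R d₁ Γ α σ₀ σ Lop ρ s' : ℝ} (hc : 0 < c) (hR₁ : 0 < R₁)
    (hGc : ContinuousOn (fun y => f y (g y)) (nball Ncl R₁))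
    (hacc : ∀ x y, x ∈ nball Ncl R₁ → y ∈ nball Ncl R₁ → ∀ ε : ℝ, 0 ≤ ε →
      (1 - -c * ε) * Ncl (x - y) ≤ Ncl ((x - y) - ε • (f x (g x) - f y (g y))))
    (hΓle : ∀ x : Fin n → ℝ, Nop x ≤ Γ * Ncl x) (hΓ : 0 < Γ) (hRR₁ : R ≤ R₁)
    (hRR₂ : Γ * R ≤ R₂) (hα : 0 < α)
    (hFLip : ∀ x ∈ nball Ncl R, ∀ e ∈ nball Nop (σ₀ * R),
      Ncl (f x (g (x + e)) - f x (g x)) ≤ α * Nop e)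
    {q p : Fin n → ℝ}
    (hGqc : ContinuousOn (fun y => f y (g q)) (nball Nop R₂))
    (haccq : ∀ x y, x ∈ nball Nop R₂ → y ∈ nball Nop R₂ → ∀ ε : ℝ, 0 ≤ ε →
      (1 - d₁ * ε) * Nop (x - y) ≤ Nop ((x - y) - ε • (f x (g q) - f y (g q))))
    {X : (Fin n → ℝ) → ℝ → (Fin n → ℝ)} (hXc : Continuous (X q)) (hX0 : X q 0 = q)
    (hXd : ∀ s : ℝ, 0 ≤ s → Nop (X q s) < R₂ →
        HasDerivWithinAt (X q) (f (X q s) (g q)) (Set.Ici 0) s)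
    {T : ℝ} (hT : ∀ s, 0 ≤ s → s < T → Nop (X q s) < R₂ ∧ psiLog Nop d₁ Lop ρ X s q ≤ σ * Ncl q)
    (hqp : Nop (q - p) ≤ Lop * (1 - ρ) / (1 + ρ) * Nop q)
    (hqR : σ * Ncl q < σ₀ * R) (hqs : α * (σ * Ncl q) ≤ c * s' * Ncl p) (hs' : 0 < s' ∧ s' < 1)
    {R' : ℝ} (hR' : R' ≤ R) (hp : Ncl p < R')
    {y : ℝ → (Fin n → ℝ)} (hy : Continuous y) (hy0 : y 0 = p)
    (hyd : ∀ s ∈ Ico 0 T, Ncl (y s) < R' → HasDerivWithinAt y (f (y s) (g q)) (Ici s) s) :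
    ∀ s ∈ Icc 0 T, Ncl (y s) < R' ∧
      Ncl (y s) ≤ (Real.exp (-c * s) * (1 - s') + s') * Ncl p := by
  have core : ∀ b ≤ T, (∀ s ∈ Ico 0 b, Ncl (y s) < R') → ∀ s ∈ Icc 0 b,
      Ncl (y s) ≤ (Real.exp (-c * s) * (1 - s') + s') * Ncl p := by
    intro b hb hyR s hs
    have hyR2 : ∀ s ∈ Ico 0 b, Nop (y s) < R₂ := fun s hs => by
      have h1 := hΓle (y s)
      have h2 : Γ * Ncl (y s) < Γ * R := mul_lt_mul_of_pos_left ((hyR s hs).trans_le hR') hΓ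
      linarith
    have hdiff := op_diff hNop hGqc haccq (z := X q) (y := y) hXc hy (b := b)
      (fun s hs => (hT s hs.1 (hs.2.trans_le hb)).1) hyR2
      (fun s hs => (hXd s hs.1 (hT s hs.1 (hs.2.trans_le hb)).1).mono (Ici_subset_Ici.2 hs.1))
      (fun s hs => hyd s ⟨hs.1, hs.2.trans_le hb⟩ (hyR s hs))
    have he : ∀ s ∈ Ico 0 b, Nop (q - y s) ≤ σ * Ncl q := by
      intro s hs
      have h1 := hdiff s ⟨hs.1, hs.2.le⟩
      rw [hX0, hy0] at h1
      have h2 := (hT s hs.1 (hs.2.trans_le hb)).2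
      unfold psiLog at h2
      have h3 := hNop.add_le (q - X q s) (X q s - y s)
      rw [sub_add_sub_cancel, hNop.sub_rev q (X q s)] at h3
      have h4 := mul_le_mul_of_nonneg_right hqp (Real.exp_pos (d₁ * s)).le
      linarith
    have key := norm_gronwall hNcl hGc (hNcl.isOpen_nball _) hacc (x := y) (y := fun _ => 0)
      (p := fun s => f (y s) (g q) - f (y s) (g (y s))) (b := b) (δ := Ncl p)
      (ε := c * s' * Ncl p) hy continuous_const
      (fun s hs => (hyR s hs).trans_le (hR'.trans hRR₁))
      (fun s hs => by
        show Ncl 0 < R₁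
        rw [hNcl.map_zero]
        exact hR₁)
      (fun s hs => by
        have := hyd s ⟨hs.1, hs.2.trans_le hb⟩ (hyR s hs)
        simpa [hf0] using this)
      (fun s hs => by
        have h1 := he s hs
        have h2 := hFLip (y s) ((hyR s hs).trans_le hR') (q - y s) (h1.trans_lt hqR)
        rw [add_sub_cancel] at h2
        exact h2.trans ((mul_le_mul_of_nonneg_left h1 hα.le).trans hqs))
      (by simp [hy0]) s hs
    rw [gronwall_cl _ _ _ _ hc] at key
    simpa using key
  have hle : ∀ s, 0 ≤ s → (Real.exp (-c * s) * (1 - s') + s') * Ncl p ≤ Ncl p := by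
    intro s hs
    have h1 : Real.exp (-c * s) ≤ 1 := by
      rw [Real.exp_le_one_iff]
      nlinarith
    have h2 : Real.exp (-c * s) * (1 - s') ≤ 1 * (1 - s') :=
      mul_le_mul_of_nonneg_right h1 (by linarith [hs'.2])
    have h3 := mul_le_mul_of_nonneg_right (by linarith : Real.exp (-c * s) * (1 - s') + s' ≤ 1)
      (hNcl.nonneg p)
    linarith
  have hball : ∀ s ∈ Icc 0 T, Ncl (y s) < R' := by
    refine first_exit (u := fun s => Ncl (y s)) (hNcl.continuous.comp hy) ?_
    intro τ hτ h
    exact ((core τ hτ.2 h τ ⟨hτ.1, le_rfl⟩).trans (hle τ hτ.1)).trans_lt hp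
  intro s hs
  exact ⟨hball s hs, core T le_rfl (fun s hs => hball s ⟨hs.1, hs.2.le⟩) s hs⟩

set_option maxHeartbeats 4000000 in
theorem stmt8
    {n m : ℕ} (hn : 0 < n) (hm : 0 < m)
    (f : (Fin n → ℝ) → (Fin m → ℝ) → (Fin n → ℝ)) (g : (Fin n → ℝ) → (Fin m → ℝ))
    (hf : Continuous (fun p : (Fin n → ℝ) × (Fin m → ℝ) => f p.1 p.2)) (hg : Continuous g)
    (hf0 : f 0 (g 0) = 0)
    -- Assumption 1
    (Ncl : (Fin n → ℝ) → ℝ) (hNcl : IsVecNorm Ncl) (c R₁ : ℝ) (hc : 0 < c) (hR₁ : 0 < R₁)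
    (hLip : ∀ x ∈ nball Ncl R₁, ∃ (K : NNReal) (ε : ℝ), 0 < ε ∧
      LipschitzOnWith K (fun y => f y (g y)) (Metric.ball x ε ∩ nball Ncl R₁))
    (hmucl : ∀ᵐ x ∂(volume : Measure (Fin n → ℝ)), x ∈ nball Ncl R₁ →
      DifferentiableAt ℝ (fun y => f y (g y)) x ∧
      logNorm Ncl (jacobian (fun y => f y (g y)) x) ≤ -c)
    -- Assumption 2
    (Nop : (Fin n → ℝ) → ℝ) (hNop : IsVecNorm Nop) (d₁ d₂ R₂ : ℝ)
    (hd₁ : 0 ≤ d₁) (hd₂ : 0 < d₂) (hR₂ : 0 < R₂)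
    (hC1 : ∀ q ∈ nball Nop R₂, ContDiffOn ℝ 1 (fun x => f x (g q)) (nball Nop R₂))
    (hmuop : ∀ q ∈ nball Nop R₂, ∀ x ∈ nball Nop R₂,
      logNorm Nop (jacobian (fun y => f y (g q)) x) ≤ d₁)
    (hfqq : ∀ q ∈ nball Nop R₂, Nop (f q (g q)) ≤ d₂ * Nop q)
    -- the constants Γ and R
    (Γ R : ℝ) (hΓ : 0 < Γ) (hΓle : ∀ x : Fin n → ℝ, Nop x ≤ Γ * Ncl x)
    (hR : R = min R₁ (R₂ / Γ))
    -- Assumption 3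
    (α σ₀ : ℝ) (hα : 0 < α) (hσ₀ : 0 < σ₀)
    (hFLip : ∀ x ∈ nball Ncl R, ∀ e ∈ nball Nop (σ₀ * R),
      Ncl (f x (g (x + e)) - f x (g x)) ≤ α * Nop e)
    -- equivalence of ‖·‖_cl with a diagonally-weighted ∞-norm
    (θcl : Fin n → ℝ) (hθcl : ∀ i, 0 < θcl i)
    (Lcl1 Lcl2 : ℝ) (hLcl1 : 0 < Lcl1) (hLcl2 : 0 < Lcl2)
    (hclEquiv : ∀ x : Fin n → ℝ,
      Lcl1 * wnorm ⊤ θcl x ≤ Ncl x ∧ Ncl x ≤ Lcl2 * wnorm ⊤ θcl x)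
    (Lcl : ℝ) (hLcl : Lcl = Lcl2 / Lcl1)
    -- equivalence of ‖·‖_op with a diagonally-weighted r-norm
    (θop : Fin n → ℝ) (hθop : ∀ i, 0 < θop i) (r : ℝ≥0∞) (hr : 1 ≤ r)
    (Lop1 Lop2 : ℝ) (hLop1 : 0 < Lop1) (hLop2 : 0 < Lop2)
    (hopEquiv : ∀ x : Fin n → ℝ,
      Lop1 * wnorm r θop x ≤ Nop x ∧ Nop x ≤ Lop2 * wnorm r θop x)
    (Lop : ℝ) (hLop : Lop = Lop2 / Lop1)
    (ρ : ℝ) (hρ : 0 < ρ ∧ ρ < 1)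
    -- Assumption 4
    (χ₀ : ℝ) (hχ₀pos : 0 < χ₀) (hχ₀ : R / Lcl2 ≤ χ₀ ∧ χ₀ < 2 * R / (Lcl2 * (1 + ρ)))
    -- the logarithmic quantizer with density ρ and parameters χ_{i,0} = χ₀ / θcl i
    (Qlog : (Fin n → ℝ) → (Fin n → ℝ))
    (hQ0 : ∀ (x : Fin n → ℝ) (i : Fin n), x i = 0 → Qlog x i = 0)
    (hQpos : ∀ (x : Fin n → ℝ) (i : Fin n) (j : ℤ),
      ρ ^ (j + 1) * (χ₀ / θcl i) ≤ x i → x i < ρ ^ j * (χ₀ / θcl i) →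
      Qlog x i = (ρ ^ j * (χ₀ / θcl i) + ρ ^ (j + 1) * (χ₀ / θcl i)) / 2)
    (hQneg : ∀ (x : Fin n → ℝ) (i : Fin n), x i < 0 → Qlog x i = - Qlog (-x) i)
    -- `X q` is the (predicted) trajectory of the open-loop system starting at `q`
    (X : (Fin n → ℝ) → ℝ → (Fin n → ℝ))
    (hX : ∀ qq : Fin n → ℝ, Continuous (X qq) ∧ X qq 0 = qq ∧
      ∀ s : ℝ, 0 ≤ s → Nop (X qq s) < R₂ →
        HasDerivWithinAt (X qq) (f (X qq s) (g qq)) (Set.Ici 0) s)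
    (σ σ₁ : ℝ) (hσpos : 0 < σ) (hσub : σ ≤ σ₀)
    (hσ₁ : σ₁ = 2 * c * ρ / (α * Lcl * (1 + ρ)))
    (hcond : Γ * Lop * (1 - ρ) / (1 + ρ) < σ ∧ σ < σ₁)
    (τmax : ℝ) (hτmax : 0 < τmax)
    (τmin : ℝ) (hτmin : 0 < τmin ∧
      Lop * (1 - ρ) / (1 + ρ) * Real.exp (d₁ * τmin) + nu d₁ d₂ τmin = σ / Γ)
    (lam : ℝ) (hlam : (1 + ρ) * Lcl2 * χ₀ / (2 * R) < lam ∧ lam < 1)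
    (τtmin : ℝ) (hτtmin : 0 < τtmin ∧ lam * (1 + nu d₁ d₂ τtmin) = 1)
    (γ : ℝ) (hγ : γ = -(1 / τmax) *
      Real.log (Real.exp (-c * τmax) * (1 - σ / σ₁) + σ / σ₁))
    (x₀ : Fin n → ℝ) (hx₀ : Ncl x₀ < R / Lcl) :
    ∃ (x : ℝ → (Fin n → ℝ)) (t : ℕ → ℝ) (q : ℕ → (Fin n → ℝ)),
      ClosedLoopLog f g Ncl Nop R₂ τmax σ d₁ Lop ρ X Qlog x₀ x t q ∧
      (0 < min τmax (min τmin τtmin) ∧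
        ∀ k : ℕ, min τmax (min τmin τtmin) ≤ t (k + 1) - t k) ∧
      (∀ (x' : ℝ → (Fin n → ℝ)) (t' : ℕ → ℝ) (q' : ℕ → (Fin n → ℝ)),
        ClosedLoopLog f g Ncl Nop R₂ τmax σ d₁ Lop ρ X Qlog x₀ x' t' q' →
        ∀ s : ℝ, 0 ≤ s → x' s = x s) ∧
      (0 < γ ∧ ∀ s : ℝ, 0 ≤ s → Ncl (x s) ≤ Real.exp (-γ * s) * Ncl x₀) := by
  classical
  have hR₂Γ : 0 < R₂ / Γ := div_pos hR₂ hΓ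
  have hRpos : 0 < R := hR ▸ lt_min hR₁ hR₂Γ
  have hRR₁ : R ≤ R₁ := hR ▸ min_le_left _ _
  have hRR₂ : Γ * R ≤ R₂ := by
    have h1 : R ≤ R₂ / Γ := hR ▸ min_le_right _ _
    rw [le_div_iff₀ hΓ] at h1
    linarith
  have hρ1 : 0 < 1 + ρ := by linarith [hρ.1]
  have hne : ∃ x : Fin n → ℝ, 0 < Ncl x := by
    refine ⟨fun _ => 1, hNcl.pos ?_⟩
    intro h
    have := congrFun h ⟨0, hn⟩
    simp at this
  have hL12 : Lcl1 ≤ Lcl2 := by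
    obtain ⟨x, hx⟩ := hne
    obtain ⟨h1, h2⟩ := hclEquiv x
    by_contra hc
    push Not at hc
    have : 0 < wnorm ⊤ θcl x := by
      by_contra hw
      push Not at hw
      nlinarith
    nlinarith
  have hLcl1' : 1 ≤ Lcl := by
    rw [hLcl, le_div_iff₀ hLcl1]
    linarith
  have hLclpos : 0 < Lcl := by linarith
  have hRL : R / Lcl ≤ R := div_le_self hRpos.le hLcl1'
  have hσ₁pos : 0 < σ₁ := hσpos.trans hcond.2
  have hs' : 0 < σ / σ₁ ∧ σ / σ₁ < 1 := ⟨div_pos hσpos hσ₁pos, (div_lt_one hσ₁pos).2 hcond.2⟩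
  have hχR : Lcl2 * ((1 + ρ) / 2 * χ₀) < lam * R := by
    have h1 := hlam.1
    rw [div_lt_iff₀ (by linarith)] at h1
    linarith
  have hlam0 : 0 < lam := by
    have : 0 < (1 + ρ) * Lcl2 * χ₀ / (2 * R) := by positivity
    linarith [hlam.1]
  -- quantizer facts
  have hQa : ∀ p, Nop (Qlog p - p) ≤ Lop * (1 - ρ) / (1 + ρ) * Nop (Qlog p) := by
    intro p
    have h1 := wnorm_mono hn r hr θop (Qlog p - p) (Qlog p) ((1 - ρ) / (1 + ρ))
      (div_nonneg (by linarith [hρ.2]) hρ1.le)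
      (fun i => (quant_vec hρ hχ₀pos hθcl Qlog hQ0 hQpos hQneg p i).1)
    have h2 := (hopEquiv (Qlog p - p)).2
    have h3 := (hopEquiv (Qlog p)).1
    have h4 : wnorm r θop (Qlog p) ≤ Nop (Qlog p) / Lop1 := by
      rw [le_div_iff₀ hLop1]
      linarith
    have hk : 0 ≤ (1 - ρ) / (1 + ρ) := div_nonneg (by linarith [hρ.2]) hρ1.le
    calc Nop (Qlog p - p) ≤ Lop2 * ((1 - ρ) / (1 + ρ) * (Nop (Qlog p) / Lop1)) :=
          h2.trans (mul_le_mul_of_nonneg_left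
            (h1.trans (mul_le_mul_of_nonneg_left h4 hk)) hLop2.le)
      _ = _ := by
          rw [hLop]
          field_simp
  have hQb : ∀ p, Ncl (Qlog p) ≤ Lcl * (1 + ρ) / (2 * ρ) * Ncl p := by
    intro p
    have hk : 0 ≤ (1 + ρ) / (2 * ρ) := div_nonneg hρ1.le (by linarith [hρ.1])
    have h1 := wnorm_mono hn ⊤ le_top θcl (Qlog p) p ((1 + ρ) / (2 * ρ)) hk
      (fun i => (quant_vec hρ hχ₀pos hθcl Qlog hQ0 hQpos hQneg p i).2.1)
    have h2 := (hclEquiv (Qlog p)).2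
    have h3 := (hclEquiv p).1
    have h4 : wnorm ⊤ θcl p ≤ Ncl p / Lcl1 := by
      rw [le_div_iff₀ hLcl1]
      linarith
    calc Ncl (Qlog p) ≤ Lcl2 * ((1 + ρ) / (2 * ρ) * (Ncl p / Lcl1)) :=
          h2.trans (mul_le_mul_of_nonneg_left
            (h1.trans (mul_le_mul_of_nonneg_left h4 hk)) hLcl2.le)
      _ = _ := by
          rw [hLcl]
          field_simp
  have hQc : ∀ p, Ncl p < R / Lcl → Ncl (Qlog p) < lam * R := by
    intro p hp
    have : Nonempty (Fin n) := ⟨⟨0, hn⟩⟩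
    have h3 := (hclEquiv p).1
    have h4 : wnorm ⊤ θcl p < χ₀ := by
      refine lt_of_lt_of_le ?_ hχ₀.1
      rw [lt_div_iff₀ hLcl2]
      rw [hLcl, lt_div_iff₀ (div_pos hLcl2 hLcl1)] at hp
      have h5 : Lcl1 * wnorm ⊤ θcl p * (Lcl2 / Lcl1) ≤ Ncl p * (Lcl2 / Lcl1) :=
        mul_le_mul_of_nonneg_right h3 (div_pos hLcl2 hLcl1).le
      have h6 : Lcl1 * wnorm ⊤ θcl p * (Lcl2 / Lcl1) = wnorm ⊤ θcl p * Lcl2 := by field_simp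
      linarith
    have h5 : ∀ i, |p i| < χ₀ / θcl i := by
      intro i
      rw [lt_div_iff₀ (hθcl i)]
      rw [wnorm_top] at h4
      have h6 : |θcl i * p i| ≤ ⨆ i, |θcl i * p i| :=
        le_ciSup (f := fun i => |θcl i * p i|) (Set.finite_range _).bddAbove i
      rw [abs_mul, abs_of_pos (hθcl i)] at h6
      linarith
    have h7 : wnorm ⊤ θcl (Qlog p) ≤ (1 + ρ) / 2 * χ₀ := by
      rw [wnorm_top]
      apply ciSup_le
      intro i
      have h8 := (quant_vec hρ hχ₀pos hθcl Qlog hQ0 hQpos hQneg p i).2.2 (h5 i)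
      rw [abs_mul, abs_of_pos (hθcl i)]
      have h9 := mul_le_mul_of_nonneg_left h8 (hθcl i).le
      have h10 : θcl i * ((1 + ρ) / 2 * (χ₀ / θcl i)) = (1 + ρ) / 2 * χ₀ := by
        have := (hθcl i).ne'
        field_simp
      linarith
    exact ((hclEquiv (Qlog p)).2.trans (mul_le_mul_of_nonneg_left h7 hLcl2.le)).trans_lt hχR
  have hlamR : lam * R < R := by nlinarith [hlam.2]
  have hQd : ∀ p, Ncl p < R / Lcl → Nop (Qlog p) < lam * R₂ := by
    intro p hp
    have h1 := mul_lt_mul_of_pos_left (hQc p hp) hΓ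
    have h2 := hΓle (Qlog p)
    have h3 := mul_le_mul_of_nonneg_left hRR₂ hlam0.le
    linarith
  have hlamR₂ : lam * R₂ < R₂ := by nlinarith [hlam.2]
  -- vector fields
  have hLL := llip_cl hLip
  have hacl := accretive hNcl hn (hNcl.isOpen_nball R₁) (hNcl.convex_lt R₁) hLL hmucl
  have hLLq : ∀ q ∈ nball Nop R₂, LocallyLipschitzOn (nball Nop R₂) (fun x => f x (g q)) :=
    fun q hq => llip_op (hNop.isOpen_nball R₂) (hC1 q hq)
  have hacq : ∀ q ∈ nball Nop R₂, ∀ x y, x ∈ nball Nop R₂ → y ∈ nball Nop R₂ → ∀ ε : ℝ, 0 ≤ ε →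
      (1 - d₁ * ε) * Nop (x - y) ≤ Nop ((x - y) - ε • (f x (g q) - f y (g q))) :=
    fun q hq => accretive hNop hn (hNop.isOpen_nball R₂) (hNop.convex_lt R₂) (hLLq q hq)
      (Filter.Eventually.of_forall fun x hx =>
        ⟨((hC1 q hq).contDiffAt ((hNop.isOpen_nball R₂).mem_nhds hx)).differentiableAt one_ne_zero,
          hmuop q hq x hx⟩)
  have hGqc : ∀ q ∈ nball Nop R₂, ContinuousOn (fun x => f x (g q)) (nball Nop R₂) :=
    fun q hq => (hC1 q hq).continuousOn
  have hLop0 : 0 < Lop := hLop ▸ div_pos hLop2 hLop1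
  have hA0 : 0 ≤ Lop * (1 - ρ) / (1 + ρ) :=
    div_nonneg (mul_nonneg hLop0.le (by linarith [hρ.2])) hρ1.le
  -- lower bound on the inter-sampling times
  have hlow : ∀ p, Ncl p < R / Lcl → min τmax (min τmin τtmin) ≤
      tauSamp Ncl Nop R₂ τmax σ d₁ Lop ρ X (Qlog p) := by
    intro p hp
    have hq2 := hQd p hp
    set q := Qlog p with hqdef
    have hq : q ∈ nball Nop R₂ := hq2.trans hlamR₂
    obtain ⟨hXc, hX0, hXd⟩ := hX q
    have hb := pred_ball hNop (hGqc q hq) hd₂ (hacq q hq) hq (hfqq q hq) hXc hX0 hXd hτtmin.2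
      hlam0 hq2
    have hb2 := pred_bound hNop (hGqc q hq) (hacq q hq) hq (hfqq q hq) hXc hX0 hXd (b := τtmin)
      (fun s hs => hb s ⟨hs.1, hs.2.le⟩)
    refine le_tauSamp (fun s h0 h1 => hb s ⟨h0, h1⟩) ?_
    intro s h0 h1 h2
    have h3 := hb2 s ⟨h0, h1⟩
    have h4 := nu_mono d₁ d₂ hd₂ h2
    have h5 : Real.exp (d₁ * s) ≤ Real.exp (d₁ * τmin) :=
      Real.exp_le_exp.2 (mul_le_mul_of_nonneg_left h2 hd₁)
    have h6 := mul_le_mul_of_nonneg_left h5 hA0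
    have h7 := hNop.nonneg q
    have h8 := hτmin.2
    have h9 := mul_le_mul_of_nonneg_right (by linarith :
      Lop * (1 - ρ) / (1 + ρ) * Real.exp (d₁ * s) + nu d₁ d₂ s ≤ σ / Γ) h7
    have h10 : σ / Γ * Nop q ≤ σ * Ncl q := by
      rw [div_mul_eq_mul_div, div_le_iff₀ hΓ]
      have := mul_le_mul_of_nonneg_left (hΓle q) hσpos.le
      linarith
    unfold psiLog
    linarith
  have hδ : 0 < min τmax (min τmin τtmin) := lt_min hτmax (lt_min hτmin.1 hτtmin.1)
  have hτle : ∀ q, tauSamp Ncl Nop R₂ τmax σ d₁ Lop ρ X q ≤ τmax :=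
    fun q => tauSamp_le.trans tauTilde_le
  -- before the next sampling instant
  have hD : ∀ q ∈ nball Nop R₂, ∀ s, 0 ≤ s → s < tauSamp Ncl Nop R₂ τmax σ d₁ Lop ρ X q →
      Nop (X q s) < R₂ ∧ psiLog Nop d₁ Lop ρ X s q ≤ σ * Ncl q := by
    intro q hq s h0 h1
    rcases h0.eq_or_lt with h | h
    · subst h
      obtain ⟨hXc, hX0, hXd⟩ := hX q
      refine ⟨by rw [hX0]; exact hq, ?_⟩
      unfold psiLog
      rw [hX0, sub_self, hNop.map_zero, mul_zero, Real.exp_zero, mul_one, add_zero]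
      have h2 := mul_le_mul_of_nonneg_left (hΓle q) hA0
      have h3 := mul_le_mul_of_nonneg_right hcond.1.le (hNcl.nonneg q)
      have h4 : Lop * (1 - ρ) / (1 + ρ) * (Γ * Ncl q) = Γ * Lop * (1 - ρ) / (1 + ρ) * Ncl q := by
        ring
      linarith
    · exact ⟨lt_of_lt_tauTilde h (h1.trans_le tauSamp_le), psi_le_of_lt_tauSamp h h1⟩
  have hap : ∀ p, Ncl p < R / Lcl → ∀ R' ≤ R, Ncl p < R' → ∀ y : ℝ → (Fin n → ℝ),
      Continuous y → y 0 = p →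
      (∀ s ∈ Ico 0 (tauSamp Ncl Nop R₂ τmax σ d₁ Lop ρ X (Qlog p)), Ncl (y s) < R' →
        HasDerivWithinAt y (f (y s) (g (Qlog p))) (Ici s) s) →
      ∀ s ∈ Icc 0 (tauSamp Ncl Nop R₂ τmax σ d₁ Lop ρ X (Qlog p)), Ncl (y s) < R' ∧
        Ncl (y s) ≤ (Real.exp (-c * s) * (1 - σ / σ₁) + σ / σ₁) * Ncl p := by
    intro p hp R' hR' hpR' y hy hy0 hyd
    have hq : Qlog p ∈ nball Nop R₂ := (hQd p hp).trans hlamR₂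
    obtain ⟨hXc, hX0, hXd⟩ := hX (Qlog p)
    refine apriori hf0 hNcl hNop hc hR₁ hLL.continuousOn hacl hΓle hΓ hRR₁ hRR₂ hα hFLip
      (hGqc _ hq) (hacq _ hq) hXc hX0 hXd (hD _ hq) (hQa p) ?_ ?_ hs' hR' hpR' hy hy0 hyd
    · have h1 := (hQc p hp).trans hlamR
      have h2 := mul_lt_mul_of_pos_left h1 hσpos
      have h3 := mul_le_mul_of_nonneg_right hσub hRpos.le
      linarith
    · have h1 := mul_le_mul_of_nonneg_left (hQb p) (mul_pos hα hσpos).le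
      have h2 : α * σ * (Lcl * (1 + ρ) / (2 * ρ) * Ncl p) = c * (σ / σ₁) * Ncl p := by
        have := hρ.1.ne'
        rw [hσ₁]
        field_simp
      linarith
  have hPle : ∀ p s, 0 ≤ s → (Real.exp (-c * s) * (1 - σ / σ₁) + σ / σ₁) * Ncl p ≤ Ncl p := by
    intro p s hs
    have h1 : Real.exp (-c * s) ≤ 1 := by
      rw [Real.exp_le_one_iff]
      nlinarith
    have h2 : Real.exp (-c * s) * (1 - σ / σ₁) ≤ 1 * (1 - σ / σ₁) :=
      mul_le_mul_of_nonneg_right h1 (by linarith [hs'.2])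
    have h3 := mul_le_mul_of_nonneg_right
      (by linarith : Real.exp (-c * s) * (1 - σ / σ₁) + σ / σ₁ ≤ 1) (hNcl.nonneg p)
    linarith
  obtain ⟨x, t, q, hcl, hgap, hP, hdecay⟩ := glue Ncl (fun p => Ncl p < R / Lcl) Qlog
    (fun q x => f x (g q)) (tauSamp Ncl Nop R₂ τmax σ d₁ Lop ρ X) (min τmax (min τmin τtmin)) γ hδ
    (by
      intro p hp
      refine ⟨hlow p hp, ?_⟩
      have hq : Qlog p ∈ nball Nop R₂ := (hQd p hp).trans hlamR₂
      have hpR : Ncl p < R := hp.trans_le hRL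
      have hsub : {x | Ncl x ≤ (Ncl p + R) / 2} ⊆ nball Nop R₂ := by
        intro x hx
        have hx' : Ncl x ≤ (Ncl p + R) / 2 := hx
        have h1 : Ncl x < R := by linarith
        have h2 := mul_lt_mul_of_pos_left h1 hΓ
        have h3 := hΓle x
        show Nop x < R₂
        linarith
      obtain ⟨y, hy, hy0, hyd⟩ := ode_exists2 (hNcl.isCompact_le ((Ncl p + R) / 2))
        ((hLLq _ hq).mono hsub) p (tauSamp Ncl Nop R₂ τmax σ d₁ Lop ρ X (Qlog p))
        (hδ.trans_le (hlow p hp))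
      have h := hap p hp ((Ncl p + R) / 2) (by linarith) (by linarith) y hy hy0
        (fun s hs hs2 => hyd s hs hs2.le)
      refine ⟨y, hy, hy0, fun s hs => hyd s hs (h s ⟨hs.1, hs.2.le⟩).1.le, fun s hs => ⟨?_, ?_⟩⟩
      · exact (h s hs).2.trans (mul_le_mul_of_nonneg_right
          (exp_decay hs' hτmax ⟨hs.1, hs.2.trans (hτle _)⟩ hγ) (hNcl.nonneg p))
      · exact ((h s hs).2.trans (hPle p s hs.1)).trans_lt hp)
    x₀ hx₀
  refine ⟨x, t, q, hcl, ⟨hδ, hgap⟩, ?_, gamma_pos hc hs' hτmax hγ, hdecay⟩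
  intro x' t' q' hcl'
  refine glue_unique (fun p => Ncl p < R / Lcl) Qlog
    (fun q x => f x (g q)) (tauSamp Ncl Nop R₂ τmax σ d₁ Lop ρ X) (min τmax (min τmin τtmin)) hδ
    ?_ x₀ x t q hcl hgap hP x' t' q' hcl'
  intro p hp y y' hy hy' hy0 hy0' hyd hyd' s hs
  have hq : Qlog p ∈ nball Nop R₂ := (hQd p hp).trans hlamR₂
  have hpR : Ncl p < R := hp.trans_le hRL
  have h1 := hap p hp R le_rfl hpR y hy hy0 (fun s hs _ => hyd s hs)
  have h2 := hap p hp R le_rfl hpR y' hy' hy0' (fun s hs _ => hyd' s hs)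
  have hin : ∀ z : Fin n → ℝ, Ncl z < R → Nop z < R₂ := by
    intro z hz
    have h3 := mul_lt_mul_of_pos_left hz hΓ
    have h4 := hΓle z
    linarith
  have h5 := op_diff hNop (hGqc _ hq) (hacq _ hq) hy' hy
    (fun s hs => hin _ (h2 s ⟨hs.1, hs.2.le⟩).1) (fun s hs => hin _ (h1 s ⟨hs.1, hs.2.le⟩).1)
    hyd' hyd s hs
  rw [hy0, hy0', sub_self, hNop.map_zero, zero_mul] at h5
  exact sub_eq_zero.1 ((hNop.eq_zero _).1 (le_antisymm h5 (hNop.nonneg _)))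

end
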